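/- arXiv:2309.02876 — 13 statements merged into one kernel-verified Lean document; each statement's English description precedes it below -/
import Mathlib

section
/- Let G be a finite connected simple graph of diameter 2 such that B_1(x) ∪ B_1(y) = V(G) for every edge xy of G. Then B(G) admits a non-clashing teaching map of size at most 2; i.e., NCTD(B(G)) ≤ 2. -/
open SimpleGraph

/-- The ball of radius `r` centered at `x` in the graph `G`. -/
def gball {V : Type*} (G : SimpleGraph V) (x : V) (r : ℕ) : Set V :=
  {v | G.dist x v ≤ r}

/-- The family of all (distinct) balls of `G`. -/
def gballs {V : Type*} (G : SimpleGraph V) : Set (Set V) :=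
  {B | ∃ (x : V) (r : ℕ), B = gball G x r}

/-- `(Tp, Tn)` is a non-clashing teaching map (NCTM) for the family `𝒞`:
`Tp C ⊆ C`, `Tn C ⊆ Cᶜ`, and any two distinct concepts are distinguished by some
example in one of their teaching sets. -/
def IsNCTM {V : Type*} [DecidableEq V] (𝒞 : Set (Set V))
    (Tp Tn : Set V → Finset V) : Prop :=
  (∀ C ∈ 𝒞, (↑(Tp C) : Set V) ⊆ C) ∧
  (∀ C ∈ 𝒞, ∀ q ∈ Tn C, q ∉ C) ∧
  ∀ C ∈ 𝒞, ∀ C' ∈ 𝒞, C ≠ C' →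
    ∃ q ∈ (Tp C ∪ Tn C) ∪ (Tp C' ∪ Tn C'), Xor' (q ∈ C) (q ∈ C')

/-- A vertex lies in the unit ball around `x` iff it is `x` or a neighbour of `x`. -/
theorem mem_gball_one {V : Type*} {G : SimpleGraph V} (hconn : G.Connected) {x v : V} :
    v ∈ gball G x 1 ↔ v = x ∨ G.Adj x v := by
  rw [← dist_eq_one_iff_adj, eq_comm (a := v), ← hconn.dist_eq_zero_iff]
  change G.dist x v ≤ 1 ↔ _
  omega

/-- `TeachingData G C P N` says that `P` and `N` are the positive and negative examples used to
teach the ball `C`: a singleton is taught by its center and a neighbour, a unit ball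
by its center and a vertex outside it, and the whole vertex set by nothing. -/
inductive TeachingData {V : Type*} (G : SimpleGraph V) : Set V → Finset V → Finset V → Prop
  | whole : TeachingData G Set.univ ∅ ∅
  | point (x y : V) (hxy : G.Adj x y) : TeachingData G {x} {x} {y}
  | unitBall (x y : V) (hy : y ∉ gball G x 1) : TeachingData G (gball G x 1) {x} {y}

namespace TeachingData

variable {V : Type*} {G : SimpleGraph V} {C C' : Set V} {P N P' N' : Finset V}

theorem exists_of_mem_gballs (hconn : G.Connected) (hdiam_le : ∀ u v : V, G.dist u v ≤ 2)
    (hdiam_eq : ∃ u v : V, G.dist u v = 2) (hC : C ∈ gballs G) :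
    ∃ P N : Finset V, TeachingData G C P N := by
  obtain ⟨x, r, rfl⟩ := hC
  match r with
  | 0 =>
    obtain ⟨u, v, huv⟩ := hdiam_eq
    have : Nontrivial V := ⟨u, v, by rintro rfl; simp at huv⟩
    obtain ⟨y, hxy⟩ := hconn.preconnected.exists_adj_of_nontrivial x
    have h : gball G x 0 = {x} := by
      ext v
      simp [gball, hconn.dist_eq_zero_iff, eq_comm]
    exact ⟨_, _, h ▸ point x y hxy⟩
  | 1 =>
    by_cases h : gball G x 1 = Set.univ
    · exact ⟨_, _, h ▸ whole⟩
    · obtain ⟨y, hy⟩ := (Set.ne_univ_iff_exists_notMem _).1 h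
      exact ⟨_, _, unitBall x y hy⟩
  | r + 2 =>
    have h : gball G x (r + 2) = Set.univ :=
      Set.eq_univ_of_forall fun v => (hdiam_le x v).trans (by omega)
    exact ⟨_, _, h ▸ whole⟩

theorem pos_subset (h : TeachingData G C P N) : (↑P : Set V) ⊆ C := by
  cases h <;> simp [gball]

theorem neg_notMem (h : TeachingData G C P N) : ∀ q ∈ N, q ∉ C := by
  cases h with
  | whole => simp
  | point x y hxy => simpa using hxy.ne'
  | unitBall x y hy => simpa using hy

theorem card_le [DecidableEq V] (h : TeachingData G C P N) : (P ∪ N).card ≤ 2 :=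
  (Finset.card_union_le _ _).trans (by cases h <;> simp)

theorem distinguish [DecidableEq V] (hconn : G.Connected)
    (hcover : ∀ x y : V, G.Adj x y → gball G x 1 ∪ gball G y 1 = Set.univ)
    (h : TeachingData G C P N) (h' : TeachingData G C' P' N') (hne : C ≠ C') :
    ∃ q ∈ (P ∪ N) ∪ (P' ∪ N'), Xor (q ∈ C) (q ∈ C') := by
  simp only [Finset.mem_union]
  cases h with
  | whole =>
    cases h' with
    | whole => exact absurd rfl hne
    | point x y hxy => exact ⟨y, by simp, .inl ⟨trivial, hxy.ne'⟩⟩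
    | unitBall x y hy => exact ⟨y, by simp, .inl ⟨trivial, hy⟩⟩
  | point x y hxy =>
    cases h' with
    | whole => exact ⟨y, by simp, .inr ⟨trivial, hxy.ne'⟩⟩
    | point x' y' _ =>
      have hx : x ≠ x' := fun h => hne (h ▸ rfl)
      exact ⟨x, by simp, .inl ⟨rfl, hx⟩⟩
    | unitBall x' y' _ =>
      by_cases hx : x' = x
      · subst hx
        exact ⟨y, by simp, .inr ⟨(mem_gball_one hconn).2 (.inr hxy), hxy.ne'⟩⟩
      · exact ⟨x', by simp, .inr ⟨by simp [gball], hx⟩⟩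
  | unitBall x y hy =>
    cases h' with
    | whole => exact ⟨y, by simp, .inr ⟨trivial, hy⟩⟩
    | point x' y' hxy' =>
      by_cases hx : x = x'
      · subst hx
        exact ⟨y', by simp, .inl ⟨(mem_gball_one hconn).2 (.inr hxy'), hxy'.ne'⟩⟩
      · exact ⟨x, by simp, .inl ⟨by simp [gball], hx⟩⟩
    | unitBall x' y' _ =>
      by_cases hxx' : G.Adj x x'
      · have hy' : y ∈ gball G x 1 ∪ gball G x' 1 := hcover x x' hxx' ▸ Set.mem_univ y
        exact ⟨y, by simp, .inr ⟨hy'.resolve_left hy, hy⟩⟩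
      · have hx : x ≠ x' := fun h => hne (h ▸ rfl)
        refine ⟨x, by simp, .inl ⟨by simp [gball], ?_⟩⟩
        rw [mem_gball_one hconn, G.adj_comm]
        exact not_or.2 ⟨hx, hxx'⟩

end TeachingData

/-- If `G` is a finite connected graph of diameter `2` such that
`B₁(x) ∪ B₁(y) = V(G)` for every edge `xy`, then `B(G)` admits a non-clashing
teaching map of size at most `2`, i.e. `NCTD(B(G)) ≤ 2`. -/
theorem stmt1 {V : Type*} [Fintype V] [DecidableEq V] (G : SimpleGraph V)
    (hconn : G.Connected)
    (hdiam_le : ∀ u v : V, G.dist u v ≤ 2)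
    (hdiam_eq : ∃ u v : V, G.dist u v = 2)
    (hcover : ∀ x y : V, G.Adj x y → gball G x 1 ∪ gball G y 1 = Set.univ) :
    ∃ Tp Tn : Set V → Finset V,
      IsNCTM (gballs G) Tp Tn ∧ ∀ C ∈ gballs G, (Tp C ∪ Tn C).card ≤ 2 := by
  choose! Tp Tn hT using fun C (hC : C ∈ gballs G) =>
    TeachingData.exists_of_mem_gballs hconn hdiam_le hdiam_eq hC
  exact ⟨Tp, Tn, ⟨fun C hC => (hT C hC).pos_subset, fun C hC => (hT C hC).neg_notMem,
    fun C hC C' hC' => (hT C hC).distinguish hconn hcover (hT C' hC')⟩,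
    fun C hC => (hT C hC).card_le⟩
end

section
/- Let n ≥ 2 and let G be the n-octahedron: the graph on the 2n vertices {x_1, x̄_1, …, x_n, x̄_n} in which two distinct vertices are adjacent if and only if they do not form a matched pair {x_i, x̄_i}. Then every positive non-clashing teaching map T for B(G) satisfies T⁺(V(G)) = V(G); in particular, every NCTM⁺ for B(G) has size at least 2n. -/
open SimpleGraph

/-- `T` is a positive non-clashing teaching map (NCTM⁺) for the family `𝒞`. -/
def IsPosNCTM {V : Type*} [DecidableEq V] (𝒞 : Set (Set V))
    (T : Set V → Finset V) : Prop :=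
  (∀ C ∈ 𝒞, (↑(T C) : Set V) ⊆ C) ∧
  ∀ C ∈ 𝒞, ∀ C' ∈ 𝒞, C ≠ C' →
    ∃ q ∈ T C ∪ T C', Xor' (q ∈ C) (q ∈ C')

/-- In an octahedron with at least two pairs, equal or antipodal vertices have a common
neighbour. -/
lemma octahedron_exists_common_adj {n : ℕ} (hn : 2 ≤ n) {G : SimpleGraph (Fin n × Bool)}
    (hAdj : ∀ u v : Fin n × Bool, G.Adj u v ↔ u.1 ≠ v.1) {u v : Fin n × Bool}
    (huv : u.1 = v.1) : ∃ w, G.Adj u w ∧ G.Adj w v := by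
  have : Nontrivial (Fin n) := Fin.nontrivial_iff_two_le.mpr hn
  obtain ⟨j, hj⟩ := exists_ne u.1
  exact ⟨(j, true), (hAdj _ _).2 hj.symm, (hAdj _ _).2 (huv ▸ hj)⟩

lemma octahedron_exists_walk_length_le_two {n : ℕ} (hn : 2 ≤ n)
    {G : SimpleGraph (Fin n × Bool)}
    (hAdj : ∀ u v : Fin n × Bool, G.Adj u v ↔ u.1 ≠ v.1) (u v : Fin n × Bool) :
    ∃ p : G.Walk u v, p.length ≤ 2 := by
  by_cases huv : u.1 = v.1
  · obtain ⟨w, huw, hwv⟩ := octahedron_exists_common_adj hn hAdj huv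
    exact ⟨.cons huw (.cons hwv .nil), by simp⟩
  · exact ⟨.cons ((hAdj u v).2 huv) .nil, by simp⟩

lemma octahedron_gball_two {n : ℕ} (hn : 2 ≤ n) {G : SimpleGraph (Fin n × Bool)}
    (hAdj : ∀ u v : Fin n × Bool, G.Adj u v ↔ u.1 ≠ v.1) (x : Fin n × Bool) :
    gball G x 2 = Set.univ := by
  refine Set.eq_univ_of_forall fun v => ?_
  obtain ⟨p, hp⟩ := octahedron_exists_walk_length_le_two hn hAdj x v
  exact (SimpleGraph.dist_le p).trans hp

/-- The unit ball at `x` misses exactly the antipode of `x`. -/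
lemma octahedron_gball_one {n : ℕ} (hn : 2 ≤ n) {G : SimpleGraph (Fin n × Bool)}
    (hAdj : ∀ u v : Fin n × Bool, G.Adj u v ↔ u.1 ≠ v.1) (x : Fin n × Bool) :
    gball G x 1 = {(x.1, !x.2)}ᶜ := by
  ext v
  obtain ⟨p, -⟩ := octahedron_exists_walk_length_le_two hn hAdj x v
  have hr : G.Reachable x v := ⟨p⟩
  have key : G.dist x v ≤ 1 ↔ x = v ∨ x.1 ≠ v.1 := by
    rw [Nat.le_one_iff_eq_zero_or_eq_one, hr.dist_eq_zero_iff, SimpleGraph.dist_eq_one_iff_adj,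
      hAdj]
  change G.dist x v ≤ 1 ↔ v ≠ (x.1, !x.2)
  rw [key]
  obtain ⟨i, b⟩ := x
  obtain ⟨j, c⟩ := v
  cases b <;> cases c <;> simp [eq_comm, em]

/-- Let `G` be the `n`-octahedron (`n ≥ 2`): vertices are pairs `(i, b) : Fin n × Bool`,
two distinct vertices being adjacent iff they have different indices (i.e. they do not
form the matched pair `{x_i, x̄_i}`). Then every positive non-clashing teaching map `T`
for `B(G)` satisfies `T⁺(V(G)) = V(G)`; in particular every NCTM⁺ for `B(G)` has size
at least `2n`. -/
theorem stmt2 (n : ℕ) (hn : 2 ≤ n) (G : SimpleGraph (Fin n × Bool))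
    (hAdj : ∀ u v : Fin n × Bool, G.Adj u v ↔ u.1 ≠ v.1)
    (T : Set (Fin n × Bool) → Finset (Fin n × Bool))
    (hT : IsPosNCTM (gballs G) T) :
    (↑(T Set.univ) : Set (Fin n × Bool)) = Set.univ ∧
    ∀ k : ℕ, (∀ C ∈ gballs G, (T C).card ≤ k) → 2 * n ≤ k := by
  have huniv : Set.univ ∈ gballs G :=
    ⟨(⟨0, by omega⟩, true), 2, (octahedron_gball_two hn hAdj _).symm⟩
  have hmem : ∀ v, v ∈ T Set.univ := by
    intro v
    have hball : ({v}ᶜ : Set (Fin n × Bool)) ∈ gballs G :=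
      ⟨(v.1, !v.2), 1, by rw [octahedron_gball_one hn hAdj]; simp⟩
    have hne : (Set.univ : Set (Fin n × Bool)) ≠ {v}ᶜ := fun h =>
      (h ▸ Set.mem_univ v : v ∈ ({v}ᶜ : Set (Fin n × Bool))) rfl
    obtain ⟨q, hq, hx⟩ := hT.2 _ huniv _ hball hne
    have hqv : q = v := by
      rcases hx with ⟨-, h⟩ | ⟨-, h⟩
      · exact not_not.1 h
      · exact absurd (Set.mem_univ q) h
    subst hqv
    refine (Finset.mem_union.1 hq).resolve_right fun h => ?_
    exact hT.1 _ hball h rfl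
  refine ⟨Set.eq_univ_of_forall hmem, fun k hk => ?_⟩
  have hcard := hk _ huniv
  rw [Finset.eq_univ_of_forall hmem, Finset.card_univ] at hcard
  simp only [Fintype.card_prod, Fintype.card_fin, Fintype.card_bool] at hcard
  omega
end

section
/- Let V = ℤ/5ℤ and let 𝒞₅ be the family of subsets of V consisting of all 2-element sets {u,v} with v − u ∉ {1, −1} (i.e., pairs of vertices nonadjacent in the 5-cycle), together with all 3-element sets {x, x+1, x+2} for x ∈ V. Then the positive teaching map T defined by T⁺(C) = C for each 2-element concept C, and T⁺({x, x+1, x+2}) = {x, x+1} for each 3-element concept, is a positive non-clashing teaching map of size 2 for 𝒞₅; in particular NCTD⁺(𝒞₅) ≤ 2. -/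
/-- The concept class `𝒞₅` on `ℤ/5ℤ`: all `2`-element sets `{u, v}` with
`v - u ∉ {1, -1}` (pairs nonadjacent in the 5-cycle), together with all
`3`-element sets `{x, x+1, x+2}`. -/
def C5family : Set (Set (ZMod 5)) :=
  {C | (∃ u v : ZMod 5, u ≠ v ∧ v - u ≠ 1 ∧ v - u ≠ -1 ∧ C = {u, v}) ∨
       (∃ x : ZMod 5, C = {x, x + 1, x + 2})}

/-- A concept of `𝒞₅` is, as a finset, either a nonadjacent pair taught by itself or a triple of
consecutive vertices taught by its first two elements. -/
theorem exists_finset_of_mem_C5family {T : Set (ZMod 5) → Finset (ZMod 5)}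
    (hpair : ∀ u v : ZMod 5, u ≠ v → v - u ≠ 1 → v - u ≠ -1 →
      (↑(T {u, v}) : Set (ZMod 5)) = {u, v})
    (htriple : ∀ x : ZMod 5,
      (↑(T {x, x + 1, x + 2}) : Set (ZMod 5)) = {x, x + 1})
    {C : Set (ZMod 5)} (hC : C ∈ C5family) :
    ∃ c : Finset (ZMod 5), C = ↑c ∧
      ((∃ u v : ZMod 5, (u ≠ v ∧ v - u ≠ 1 ∧ v - u ≠ -1) ∧ c = {u, v} ∧ T C = {u, v}) ∨
        ∃ x : ZMod 5, c = {x, x + 1, x + 2} ∧ T C = {x, x + 1}) := by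
  rcases hC with ⟨u, v, h₀, h₁, h₂, rfl⟩ | ⟨x, rfl⟩
  · refine ⟨{u, v}, by simp, Or.inl ⟨u, v, ⟨h₀, h₁, h₂⟩, rfl, ?_⟩⟩
    exact Finset.coe_injective (by simpa using hpair u v h₀ h₁ h₂)
  · refine ⟨{x, x + 1, x + 2}, by simp, Or.inr ⟨x, rfl, ?_⟩⟩
    exact Finset.coe_injective (by simpa using htriple x)

/-- A nonadjacent pair and a triple of consecutive vertices do not clash. -/
theorem exists_xor_mem_pair_triple : ∀ u v x : ZMod 5, (u ≠ v ∧ v - u ≠ 1 ∧ v - u ≠ -1) →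
    ∃ q ∈ ({u, v} ∪ {x, x + 1} : Finset (ZMod 5)),
      ¬(q ∈ ({u, v} : Finset (ZMod 5)) ↔ q ∈ ({x, x + 1, x + 2} : Finset (ZMod 5))) := by
  decide

/-- Distinct triples of consecutive vertices do not clash. -/
theorem exists_xor_mem_triple_triple : ∀ x y : ZMod 5,
    ({x, x + 1, x + 2} : Finset (ZMod 5)) ≠ {y, y + 1, y + 2} →
    ∃ q ∈ ({x, x + 1} ∪ {y, y + 1} : Finset (ZMod 5)),
      ¬(q ∈ ({x, x + 1, x + 2} : Finset (ZMod 5)) ↔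
        q ∈ ({y, y + 1, y + 2} : Finset (ZMod 5))) := by
  decide

/-- Distinct finsets, each taught by itself, do not clash. -/
theorem exists_xor_mem_of_ne {α : Type*} [DecidableEq α] {s t : Finset α} (h : s ≠ t) :
    ∃ q ∈ s ∪ t, ¬(q ∈ s ↔ q ∈ t) := by
  contrapose! h
  ext q
  by_cases hq : q ∈ s ∪ t
  · exact h q hq
  · simp_all

/-- The positive teaching map `T` with `T⁺(C) = C` for each `2`-element concept
`C = {u,v}` and `T⁺({x, x+1, x+2}) = {x, x+1}` for each `3`-element concept is a
positive non-clashing teaching map of size `2` for `𝒞₅`; in particular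
`NCTD⁺(𝒞₅) ≤ 2`. -/
theorem stmt3 (T : Set (ZMod 5) → Finset (ZMod 5))
    (hpair : ∀ u v : ZMod 5, u ≠ v → v - u ≠ 1 → v - u ≠ -1 →
      (↑(T {u, v}) : Set (ZMod 5)) = {u, v})
    (htriple : ∀ x : ZMod 5,
      (↑(T {x, x + 1, x + 2}) : Set (ZMod 5)) = {x, x + 1}) :
    IsPosNCTM C5family T ∧ ∀ C ∈ C5family, (T C).card ≤ 2 := by
  constructor
  · constructor
    · intro C hC
      obtain ⟨c, rfl, ⟨u, v, -, rfl, hT⟩ | ⟨x, rfl, hT⟩⟩ :=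
        exists_finset_of_mem_C5family hpair htriple hC
      · rw [hT]
      · rw [hT, Finset.coe_subset]
        exact Finset.insert_subset_insert _ (by simp)
    · intro C hC C' hC' hne
      obtain ⟨c, rfl, hc⟩ := exists_finset_of_mem_C5family hpair htriple hC
      obtain ⟨c', rfl, hc'⟩ := exists_finset_of_mem_C5family hpair htriple hC'
      rw [Ne, Finset.coe_inj] at hne
      simp only [Finset.mem_coe, Xor', xor_iff_not_iff]
      rcases hc with ⟨u, v, h, rfl, hT⟩ | ⟨x, rfl, hT⟩ <;>
        rcases hc' with ⟨u', v', h', rfl, hT'⟩ | ⟨x', rfl, hT'⟩ <;> rw [hT, hT']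
      · exact exists_xor_mem_of_ne hne
      · exact exists_xor_mem_pair_triple u v x' h
      · obtain ⟨q, hq, hxor⟩ := exists_xor_mem_pair_triple u' v' x h'
        exact ⟨q, by rwa [Finset.union_comm], fun hiff => hxor hiff.symm⟩
      · exact exists_xor_mem_triple_triple x x' hne
  · intro C hC
    obtain ⟨c, -, ⟨u, v, -, -, hT⟩ | ⟨x, -, hT⟩⟩ :=
      exists_finset_of_mem_C5family hpair htriple hC <;>
    · rw [hT]
      exact Finset.card_le_two
end

section
/- Let T be a finite tree (a finite connected acyclic simple graph), let B_{r₂}(y) be a ball of T, and let {u,v} be a diametral pair of B_{r₂}(y). If u ∈ B_{r₁}(x) and v ∈ B_{r₁}(x) for some ball B_{r₁}(x) of T, then B_{r₂}(y) ⊆ B_{r₁}(x). -/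
open SimpleGraph

/-- In an acyclic graph every path is a geodesic. -/
theorem length_eq_dist_of_isPath {V : Type*} {G : SimpleGraph V} (hG : G.IsAcyclic)
    {a b : V} {p : G.Walk a b} (hp : p.IsPath) : p.length = G.dist a b := by
  obtain ⟨q, hq, hqlen⟩ := p.reachable.exists_path_of_dist
  have h : p = q := congrArg Subtype.val ((hG.subsingleton_path a b).elim ⟨p, hp⟩ ⟨q, hq⟩)
  rw [h, hqlen]

theorem dist_add_dist_of_mem_support {V : Type*} {G : SimpleGraph V} (hG : G.IsAcyclic)
    {a b m : V} {p : G.Walk a b} (hp : p.IsPath) (hm : m ∈ p.support) :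
    G.dist a m + G.dist m b = G.dist a b := by
  obtain ⟨q, r, hq, hr, rfl⟩ := hp.mem_support_iff_exists_append.mp hm
  rw [← length_eq_dist_of_isPath hG hp, ← length_eq_dist_of_isPath hG hq,
    ← length_eq_dist_of_isPath hG hr, Walk.length_append]

/-- If the start of a path is its vertex closest to `x`, then geodesics from `x` to the end of
the path pass through the start. -/
theorem dist_add_dist_of_forall_dist_le {V : Type*} {G : SimpleGraph V} (hconn : G.Connected)
    (hG : G.IsAcyclic) {x a b : V} {p : G.Walk a b} (hp : p.IsPath)
    (hmin : ∀ w ∈ p.support, G.dist x a ≤ G.dist x w) :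
    G.dist x a + G.dist a b = G.dist x b := by
  obtain ⟨q, hq, -⟩ := hconn.exists_path_of_dist x a
  have hpath : (q.append p).IsPath := by
    rw [Walk.isPath_def, Walk.support_append, List.nodup_append']
    have hpn := hp.support_nodup
    rw [← Walk.cons_tail_support, List.nodup_cons] at hpn
    refine ⟨hq.support_nodup, hpn.2, fun w hwq hwp ↦ hpn.1 ?_⟩
    have h₁ := dist_add_dist_of_mem_support hG hq hwq
    have h₂ := hmin w (List.mem_of_mem_tail hwp)
    have h₃ : w = a := hconn.dist_eq_zero_iff.mp (by omega)
    exact h₃ ▸ hwp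
  exact dist_add_dist_of_mem_support hG hpath
    ((Walk.mem_support_append_iff _ _).mpr (Or.inr p.start_mem_support))

/-- Every vertex `x` of a tree has a projection onto a given path. -/
theorem exists_mem_support_dist_add_dist {V : Type*} {G : SimpleGraph V} (hconn : G.Connected)
    (hG : G.IsAcyclic) {a b : V} {p : G.Walk a b} (hp : p.IsPath) (x : V) :
    ∃ m ∈ p.support, G.dist x m + G.dist m a = G.dist x a ∧
      G.dist x m + G.dist m b = G.dist x b := by
  classical
  obtain ⟨m, hm, hmin⟩ := p.support.toFinset.exists_min_image (G.dist x)
    ⟨a, by simp⟩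
  simp only [List.mem_toFinset] at hm hmin
  obtain ⟨q, r, hq, hr, rfl⟩ := hp.mem_support_iff_exists_append.mp hm
  refine ⟨m, hm, dist_add_dist_of_forall_dist_le hconn hG hq.reverse fun w hw ↦ hmin w ?_,
    dist_add_dist_of_forall_dist_le hconn hG hr fun w hw ↦ hmin w ?_⟩
  · rw [Walk.support_reverse, List.mem_reverse] at hw
    exact (Walk.mem_support_append_iff _ _).mpr (Or.inl hw)
  · exact (Walk.mem_support_append_iff _ _).mpr (Or.inr hw)

/-- The four-point condition for trees. -/
theorem four_point_condition {V : Type*} {G : SimpleGraph V} (hconn : G.Connected)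
    (hG : G.IsAcyclic) (x z u v : V) :
    G.dist x z + G.dist u v ≤
      max (G.dist x u + G.dist z v) (G.dist x v + G.dist z u) := by
  obtain ⟨p, hp, -⟩ := hconn.exists_path_of_dist u v
  obtain ⟨m, hm, hxu, hxv⟩ := exists_mem_support_dist_add_dist hconn hG hp x
  obtain ⟨n, hn, hzu, hzv⟩ := exists_mem_support_dist_add_dist hconn hG hp z
  have huv := dist_add_dist_of_mem_support hG hp hm
  have hxz : G.dist x z ≤ G.dist x m + (G.dist m n + G.dist n z) :=
    hconn.dist_triangle.trans (Nat.add_le_add_left hconn.dist_triangle _)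
  obtain ⟨q, r, hq, hr, rfl⟩ := hp.mem_support_iff_exists_append.mp hm
  have hmu := G.dist_comm (u := m) (v := u)
  have hnu := G.dist_comm (u := n) (v := u)
  have hnm := G.dist_comm (u := n) (v := m)
  have hnz := G.dist_comm (u := n) (v := z)
  have huv' := dist_add_dist_of_mem_support hG hp hn
  rcases (Walk.mem_support_append_iff _ _).mp hn with hn | hn
  · have := dist_add_dist_of_mem_support hG hq hn
    exact le_max_of_le_left (by omega)
  · have := dist_add_dist_of_mem_support hG hr hn
    exact le_max_of_le_right (by omega)

/-- Let `T` be a finite tree, let `B_{r₂}(y)` be a ball of `T` and let `{u, v}` be a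
diametral pair of `B_{r₂}(y)`. If both `u` and `v` belong to a ball `B_{r₁}(x)`,
then `B_{r₂}(y) ⊆ B_{r₁}(x)`. -/
theorem stmt4 {V : Type*} [Fintype V] (G : SimpleGraph V)
    (hconn : G.Connected) (hacyclic : G.IsAcyclic)
    (x y u v : V) (r₁ r₂ : ℕ)
    (hu : u ∈ gball G y r₂) (hv : v ∈ gball G y r₂)
    (hdiam : ∀ a ∈ gball G y r₂, ∀ b ∈ gball G y r₂, G.dist a b ≤ G.dist u v)
    (hux : u ∈ gball G x r₁) (hvx : v ∈ gball G x r₁) :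
    gball G y r₂ ⊆ gball G x r₁ := by
  intro z hz
  have hzu := hdiam z hz u hu
  have hzv := hdiam z hz v hv
  have h := le_max_iff.mp (four_point_condition hconn hacyclic x z u v)
  simp only [gball, Set.mem_ofPred_eq] at hux hvx ⊢
  omega
end

section
/- Let T be a finite tree (a finite connected acyclic simple graph). The positive teaching map on B(T) that assigns to each ball B ∈ B(T) the set {u,v} for some diametral pair u,v of B (so a singleton ball B = {x} is assigned {x}) is a positive non-clashing teaching map of size at most 2 for B(T). Consequently NCTD⁺(B(T)) ≤ 2 and NCTD(B(T)) ≤ 2. -/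
open SimpleGraph

/-- A vertex on a shortest walk splits the distance between the ends. -/
theorem dist_add_dist_le_of_mem_support {V : Type*} {G : SimpleGraph V} {u w y : V}
    {p : G.Walk u w} (hp : p.length = G.dist u w) (hy : y ∈ p.support) :
    G.dist u y + G.dist y w ≤ G.dist u w := by
  classical
  have h := congrArg Walk.length (p.take_spec hy)
  rw [Walk.length_append] at h
  have h₁ := dist_le (p.takeUntil y hy)
  have h₂ := dist_le (p.dropUntil y hy)
  lia

/-- In a tree, the two sides of an edge `yz` are joined only through `y`. -/
theorem SimpleGraph.IsTree.dist_add_dist_le_of_adj {V : Type*} {G : SimpleGraph V}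
    (hG : G.IsTree) {u w y z : V} (hyz : G.Adj y z) (hu : G.dist u z = G.dist u y + 1)
    (hw : G.dist w y = G.dist w z + 1) :
    G.dist u y + G.dist y w ≤ G.dist u w := by
  obtain ⟨p, hp⟩ := hG.connected.exists_walk_length_eq_dist u w
  obtain ⟨q, hq⟩ := hG.connected.exists_walk_length_eq_dist y u
  obtain ⟨r, hr⟩ := hG.connected.exists_walk_length_eq_dist w z
  have hmem := isBridge_iff_forall_walk_mem_edges.mp
    (isAcyclic_iff_forall_adj_isBridge.mp hG.isAcyclic hyz) ((q.append p).append r)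
  simp only [Walk.edges_append, List.mem_append] at hmem
  rcases hmem with (hmem | hmem) | hmem
  · have h := dist_add_dist_le_of_mem_support hq (q.snd_mem_support_of_mem_edges hmem)
    have h₁ := G.dist_comm (u := u) (v := z)
    have h₂ := G.dist_comm (u := u) (v := y)
    lia
  · exact dist_add_dist_le_of_mem_support hp (p.fst_mem_support_of_mem_edges hmem)
  · have h := dist_add_dist_le_of_mem_support hr (r.fst_mem_support_of_mem_edges hmem)
    lia

/-- The four-point condition for the metric of a tree. -/
theorem SimpleGraph.IsTree.four_point {V : Type*} {G : SimpleGraph V} (hG : G.IsTree)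
    (u v y w : V) :
    G.dist y w + G.dist u v ≤
      max (G.dist y u + G.dist w v) (G.dist y v + G.dist w u) := by
  obtain ⟨p, hp⟩ := hG.connected.exists_walk_length_eq_dist y w
  induction p with
  | @nil y =>
    have h := hG.connected.dist_triangle (u := u) (v := y) (w := v)
    grind [dist_comm]
  | @cons y z w hyz p ih =>
    rw [Walk.length_cons] at hp
    have hle := dist_le p
    have htri := hG.connected.dist_triangle (u := y) (v := z) (w := w)
    have hone := dist_eq_one_iff_adj.mpr hyz
    have hz : p.length = G.dist z w := by lia
    have ih := ih hz
    have hw : G.dist w y = G.dist w z + 1 := by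
      rw [dist_comm, dist_comm (u := w) (v := z)]
      lia
    have hu := hG.dist_eq_dist_add_one_of_adj u hyz
    have hv := hG.dist_eq_dist_add_one_of_adj v hyz
    have htri' := hG.connected.dist_triangle (u := u) (v := y) (w := v)
    have hu' := hG.dist_add_dist_le_of_adj (u := u) hyz (w := w)
    have hv' := hG.dist_add_dist_le_of_adj (u := v) hyz (w := w)
    grind [dist_comm]

/-- In a tree, a ball containing a pair `u, v` contains every point whose distances to `u`
and `v` are at most `dist u v`. -/
theorem mem_gball_of_dist_le {V : Type*} {G : SimpleGraph V} (hG : G.IsTree)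
    {x u v w : V} {r : ℕ} (hu : u ∈ gball G x r) (hv : v ∈ gball G x r)
    (hwu : G.dist w u ≤ G.dist u v) (hwv : G.dist w v ≤ G.dist u v) :
    w ∈ gball G x r := by
  have h := hG.four_point u v x w
  simp only [gball, Set.mem_ofPred_eq] at *
  grind

theorem IsPosNCTM.isNCTM {V : Type*} [DecidableEq V] {𝒞 : Set (Set V)}
    {T : Set V → Finset V} (h : IsPosNCTM 𝒞 T) : IsNCTM 𝒞 T (fun _ => ∅) :=
  ⟨h.1, by simp, by simpa using h.2⟩

/-- A map sending each ball of a tree to a diametral pair is a positive non-clashing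
teaching map. -/
theorem isPosNCTM_of_diametral {V : Type*} [DecidableEq V] {G : SimpleGraph V}
    (hG : G.IsTree) {T : Set V → Finset V}
    (hT : ∀ B ∈ gballs G, ∃ u v : V, u ∈ B ∧ v ∈ B ∧
      (∀ a ∈ B, ∀ b ∈ B, G.dist a b ≤ G.dist u v) ∧ (↑(T B) : Set V) = {u, v}) :
    IsPosNCTM (gballs G) T := by
  have hsub : ∀ C ∈ gballs G, (↑(T C) : Set V) ⊆ C := by
    intro C hC
    obtain ⟨u, v, hu, hv, -, h⟩ := hT C hC
    rw [h]
    exact Set.pair_subset hu hv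
  have hmono : ∀ C ∈ gballs G, ∀ C' ∈ gballs G, (↑(T C) : Set V) ⊆ C' → C ⊆ C' := by
    rintro C hC _ ⟨x, r, rfl⟩ h w hw
    obtain ⟨u, v, hu, hv, hmax, huv⟩ := hT C hC
    rw [huv, Set.pair_subset_iff] at h
    exact mem_gball_of_dist_le hG h.1 h.2 (hmax w hw u hu) (hmax w hw v hv)
  refine ⟨hsub, fun C hC C' hC' hne => ?_⟩
  by_contra! hq
  refine hne ((hmono C hC C' hC' fun q hqT => ?_).antisymm
    (hmono C' hC' C hC fun q hqT => ?_))
  · have h := hq q (Finset.mem_union_left _ hqT)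
    exact (not_xor _ _ |>.mp h).mp (hsub C hC hqT)
  · have h := hq q (Finset.mem_union_right _ hqT)
    exact (not_xor _ _ |>.mp h).mpr (hsub C' hC' hqT)


/-- For a finite tree `G`, the positive teaching map assigning to each ball a diametral
pair of it is a positive non-clashing teaching map of size at most `2` for `B(G)`.
Consequently `NCTD⁺(B(G)) ≤ 2` and `NCTD(B(G)) ≤ 2`. -/
theorem stmt5 {V : Type*} [Fintype V] [DecidableEq V] (G : SimpleGraph V)
    (hconn : G.Connected) (hacyclic : G.IsAcyclic)
    (T : Set V → Finset V)
    (hT : ∀ B ∈ gballs G, ∃ u v : V, u ∈ B ∧ v ∈ B ∧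
      (∀ a ∈ B, ∀ b ∈ B, G.dist a b ≤ G.dist u v) ∧ (↑(T B) : Set V) = {u, v}) :
    (IsPosNCTM (gballs G) T ∧ ∀ B ∈ gballs G, (T B).card ≤ 2) ∧
    (∃ T' : Set V → Finset V,
      IsPosNCTM (gballs G) T' ∧ ∀ B ∈ gballs G, (T' B).card ≤ 2) ∧
    (∃ Tp Tn : Set V → Finset V,
      IsNCTM (gballs G) Tp Tn ∧ ∀ B ∈ gballs G, (Tp B ∪ Tn B).card ≤ 2) := by
  have hpos := isPosNCTM_of_diametral ⟨hconn, hacyclic⟩ hT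
  have hcard : ∀ B ∈ gballs G, (T B).card ≤ 2 := by
    intro B hB
    obtain ⟨u, v, -, -, -, h⟩ := hT B hB
    rw [← Finset.coe_pair, Finset.coe_inj] at h
    exact h ▸ Finset.card_le_two
  exact ⟨⟨hpos, hcard⟩, ⟨T, hpos, hcard⟩, ⟨T, fun _ => ∅, hpos.isNCTM, by simpa using hcard⟩⟩
end

section
/- Let I be a finite connected interval graph with interval representation (J_v)_{v∈V(I)} whose endpoints are pairwise distinct. Let B_r(x) be a ball of I and let u, v, z be vertices with u ∈ B_r(x), v ∈ B_r(x), s_u < s_v, s_z < s_v, e_u < e_v, and e_u < e_z. Then z ∈ B_r(x). -/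
open SimpleGraph

/-- A walk from an interval ending before `t` to an interval starting after `t` visits an
interval containing `t`, other than the initial one. -/
lemma exists_mem_interval_of_walk {V : Type*} {G : SimpleGraph V} {s e : V → ℝ}
    (hse : ∀ v, s v ≤ e v) (hAdj : ∀ a b, G.Adj a b → s b ≤ e a) {t : ℝ} {a b : V}
    (p : G.Walk a b) (ha : e a < t) (hb : t < s b) :
    ∃ w, s w ≤ t ∧ t ≤ e w ∧ G.dist w b + 1 ≤ p.length := by
  induction p with
  | nil => linarith [hse ‹_›]
  | @cons a c b h p ih =>
    rcases lt_or_ge (e c) t with hc | hc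
    · obtain ⟨w, hw, hw', hd⟩ := ih hc hb
      exact ⟨w, hw, hw', by rw [Walk.length_cons]; omega⟩
    · exact ⟨c, (hAdj a c h).trans ha.le, hc, by
        rw [Walk.length_cons]; exact Nat.succ_le_succ (dist_le p)⟩

/-- If `u` ends before `z` and `z` ends before `x` starts, then `z` is at least as close to `x`
as `u`. -/
lemma dist_le_dist_of_end_lt {V : Type*} {G : SimpleGraph V} {s e : V → ℝ}
    (hse : ∀ v, s v ≤ e v) (hAdj : ∀ a b, G.Adj a b ↔ a ≠ b ∧ s a ≤ e b ∧ s b ≤ e a)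
    (hconn : G.Connected) {u z x : V} (huz : e u < e z) (hzx : e z < s x) :
    G.dist z x ≤ G.dist u x := by
  obtain ⟨p, hp⟩ := hconn.exists_walk_length_eq_dist u x
  obtain ⟨w, hw, hw', hd⟩ :=
    exists_mem_interval_of_walk hse (fun a b h => ((hAdj a b).1 h).2.2) p huz hzx
  rw [hp] at hd
  rcases eq_or_ne z w with rfl | hne
  · omega
  · have hzw : G.dist z w = 1 :=
      dist_eq_one_iff_adj.2 ((hAdj z w).2 ⟨hne, (hse z).trans hw', hw⟩)
    have htri : G.dist z x ≤ G.dist z w + G.dist w x := hconn.dist_triangle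
    omega

/-- Let `I` be a finite connected interval graph with interval representation
`J_v = [s v, e v]` whose `2|V|` endpoints are pairwise distinct. If `u, v ∈ B_r(x)`,
`s u < s v`, `s z < s v`, `e u < e v` and `e u < e z`, then `z ∈ B_r(x)`. -/
theorem stmt6 {V : Type*} [Fintype V] (G : SimpleGraph V)
    (s e : V → ℝ) (hse : ∀ v : V, s v ≤ e v)
    (hs_inj : ∀ u v : V, s u = s v → u = v)
    (he_inj : ∀ u v : V, e u = e v → u = v)
    (hse_ne : ∀ u v : V, s u ≠ e v)
    (hAdj : ∀ u v : V, G.Adj u v ↔ u ≠ v ∧ s u ≤ e v ∧ s v ≤ e u)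
    (hconn : G.Connected)
    (x u v z : V) (r : ℕ)
    (hu : u ∈ gball G x r) (hv : v ∈ gball G x r)
    (h1 : s u < s v) (h2 : s z < s v) (h3 : e u < e v) (h4 : e u < e z) :
    z ∈ gball G x r := by
  simp only [gball, Set.mem_ofPred_eq] at *
  rcases lt_or_ge (e z) (s x) with hzx | hzx
  · have hd := dist_le_dist_of_end_lt hse hAdj hconn h4 hzx
    rw [G.dist_comm (u := x)] at *
    exact hd.trans hu
  rcases lt_or_ge (e x) (s z) with hxz | hxz
  · have hd := dist_le_dist_of_end_lt (s := fun w => -e w) (e := fun w => -s w)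
      (fun w => neg_le_neg (hse w))
      (fun a b => by simp only [neg_le_neg_iff]; rw [hAdj a b, and_comm (a := s a ≤ e b)])
      hconn (neg_lt_neg h2) (neg_lt_neg hxz)
    rw [G.dist_comm (u := x)] at *
    exact hd.trans hv
  rcases eq_or_ne x z with rfl | hne
  · simp
  rw [dist_eq_one_iff_adj.2 ((hAdj x z).2 ⟨hne, hzx, hxz⟩)]
  by_contra! hr
  have hxu := hconn.dist_eq_zero_iff.1 (by omega : G.dist x u = 0)
  have hxv := hconn.dist_eq_zero_iff.1 (by omega : G.dist x v = 0)
  rw [← hxu, ← hxv] at h1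
  exact lt_irrefl _ h1
end

section
/- Let I be a finite connected interval graph with interval representation (J_v)_{v∈V(I)} whose endpoints are pairwise distinct. Let B_{r₁}(x) be a ball of I and let {u,v} be its farthest pair (u the vertex of B_{r₁}(x) with minimum end e_u, v the vertex of B_{r₁}(x) with maximum start s_v), with u ≠ v. If u ∈ B_{r₂}(y) and v ∈ B_{r₂}(y) for some ball B_{r₂}(y) of I, then B_{r₁}(x) ⊆ B_{r₂}(y). -/
open SimpleGraph

/-- In a graph of segments `[s w, e w]`, a walk whose last segment lies to the right of a point `p`
and whose first one does not has a vertex, other than its last one, whose segment contains `p`. -/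
theorem exists_dist_lt_length_of_start_le {V : Type*} {G : SimpleGraph V} {s e : V → ℝ}
    (hconn : G.Connected) (hadj : ∀ a b, G.Adj a b → s b ≤ e a) {p : ℝ} {a b : V}
    (W : G.Walk a b) (ha : s a ≤ p) (hb : p < s b) :
    ∃ z, s z ≤ p ∧ p ≤ e z ∧ G.dist a z < W.length := by
  induction W with
  | nil => exact absurd hb ha.not_gt
  | @cons a c b hac W ih =>
    rcases le_or_gt p (e a) with hp | hp
    · exact ⟨a, ha, hp, by simp⟩
    · obtain ⟨z, hz₁, hz₂, hz⟩ := ih ((hadj a c hac).trans hp.le) hb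
      refine ⟨z, hz₁, hz₂, ?_⟩
      have htri := hconn.dist_triangle (u := a) (v := c) (w := z)
      rw [dist_eq_one_iff_adj.mpr hac] at htri
      rw [Walk.length_cons]
      omega

/-- Let `I` be a finite connected interval graph with interval representation
`J_w = [s w, e w]` whose endpoints are pairwise distinct. Let `{u, v}` be the farthest
pair of a ball `B_{r₁}(x)` (`u` has minimum end and `v` has maximum start among vertices
of the ball), with `u ≠ v`. If `u, v ∈ B_{r₂}(y)`, then `B_{r₁}(x) ⊆ B_{r₂}(y)`. -/
theorem stmt7 {V : Type*} [Fintype V] (G : SimpleGraph V)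
    (s e : V → ℝ) (hse : ∀ v : V, s v ≤ e v)
    (hs_inj : ∀ u v : V, s u = s v → u = v)
    (he_inj : ∀ u v : V, e u = e v → u = v)
    (hse_ne : ∀ u v : V, s u ≠ e v)
    (hAdj : ∀ u v : V, G.Adj u v ↔ u ≠ v ∧ s u ≤ e v ∧ s v ≤ e u)
    (hconn : G.Connected)
    (x y u v : V) (r₁ r₂ : ℕ)
    (hu : u ∈ gball G x r₁) (hv : v ∈ gball G x r₁) (huv : u ≠ v)
    (hu_min : ∀ w ∈ gball G x r₁, w ≠ u → e u < e w)
    (hv_max : ∀ w ∈ gball G x r₁, w ≠ v → s w < s v)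
    (huy : u ∈ gball G y r₂) (hvy : v ∈ gball G y r₂) :
    gball G x r₁ ⊆ gball G y r₂ := by
  intro w hw
  change G.dist y u ≤ r₂ at huy
  change G.dist y v ≤ r₂ at hvy
  change G.dist y w ≤ r₂
  by_cases hwu : w = u
  · rwa [hwu]
  by_cases hwv : w = v
  · rwa [hwv]
  have hmeet : ∀ z, s z ≤ e w → s w ≤ e z → G.dist z w ≤ 1 := by
    intro z h₁ h₂
    by_cases hzw : z = w
    · simp [hzw]
    · exact (dist_eq_one_iff_adj.mpr ((hAdj z w).mpr ⟨hzw, h₁, h₂⟩)).le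
  have hstep : ∀ z, s z ≤ e w → s w ≤ e z → G.dist y z < r₂ → G.dist y w ≤ r₂ := by
    intro z h₁ h₂ h
    have htri := hconn.dist_triangle (u := y) (v := z) (w := w)
    have := hmeet z h₁ h₂
    omega
  rcases le_or_gt (s y) (s w) with hs | hs
  · obtain ⟨W, hW⟩ := hconn.exists_walk_length_eq_dist y v
    obtain ⟨z, hz₁, hz₂, hz⟩ := exists_dist_lt_length_of_start_le hconn
      (fun a b hab => ((hAdj a b).mp hab).2.2) W hs (hv_max w hw hwv)
    exact hstep z (hz₁.trans (hse w)) hz₂ (by omega)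
  rcases le_or_gt (e w) (e y) with he | he
  · obtain ⟨W, hW⟩ := hconn.exists_walk_length_eq_dist y u
    obtain ⟨z, hz₁, hz₂, hz⟩ := exists_dist_lt_length_of_start_le
      (s := fun a => -e a) (e := fun a => -s a) hconn
      (fun a b hab => neg_le_neg ((hAdj a b).mp hab).2.1) W
      (neg_le_neg he) (neg_lt_neg (hu_min w hw hwu))
    exact hstep z (neg_le_neg_iff.mp hz₂) ((hse w).trans (neg_le_neg_iff.mp hz₁)) (by omega)
  · have hr : 0 < r₂ := by
      by_contra! h
      have hyu := hconn.dist_eq_zero_iff.mp (Nat.le_zero.mp (huy.trans h))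
      have hyv := hconn.dist_eq_zero_iff.mp (Nat.le_zero.mp (hvy.trans h))
      exact huv (hyu.symm.trans hyv)
    exact hstep y ((hse y).trans he.le) (hs.le.trans (hse y)) (by simpa using hr)
end

section
/- Let k ≥ 1 and let C_n be the cycle graph on n = 2k+2 ≥ 4 vertices. Then B(C_n) does not admit a positive non-clashing teaching map of size at most k. Consequently, the families of balls of cycles do not admit NCTM⁺s of constant size. -/
open SimpleGraph

/-- In a graph on `ZMod n` whose edges join `i` to `i + 1`, there is a walk of length `m`
from `x` to `x + m`. -/
theorem exists_walk_add {n : ℕ} {G : SimpleGraph (ZMod n)}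
    (hG : ∀ i, G.Adj i (i + 1)) (x : ZMod n) (m : ℕ) :
    ∃ p : G.Walk x (x + m), p.length = m := by
  induction m with
  | zero => exact ⟨(Walk.nil : G.Walk x x).copy rfl (by simp), by simp⟩
  | succ m ih =>
    obtain ⟨p, hp⟩ := ih
    have h : G.Adj (x + m) (x + (m + 1 : ℕ)) := by
      have := hG (x + m)
      rwa [add_assoc, ← Nat.cast_succ] at this
    exact ⟨p.concat h, by simp [hp]⟩

/-- The endpoints of a walk in a cycle graph on `ZMod n` differ by (the residue of) an integer
whose absolute value is at most the length of the walk. -/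
theorem exists_int_of_walk {n : ℕ} {G : SimpleGraph (ZMod n)}
    (hG : ∀ i j, G.Adj i j → j = i + 1 ∨ i = j + 1) {x y : ZMod n} (p : G.Walk x y) :
    ∃ z : ℤ, z.natAbs ≤ p.length ∧ y = x + z := by
  induction p with
  | nil => exact ⟨0, by simp⟩
  | @cons u v w h p ih =>
    obtain ⟨z, hz, rfl⟩ := ih
    rw [Walk.length_cons]
    rcases hG _ _ h with rfl | rfl
    · exact ⟨z + 1, by omega, by push_cast; ring⟩
    · exact ⟨z - 1, by omega, by push_cast; ring⟩

/-- In the cycle graph on `2 * k + 2` vertices, a vertex lies within distance `k + 1` of any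
other one, and within distance `k` unless it is the antipode. -/
theorem exists_walk_length_le (k : ℕ) {G : SimpleGraph (ZMod (2 * k + 2))}
    (hG : ∀ i, G.Adj i (i + 1)) (x v : ZMod (2 * k + 2)) :
    ∃ p : G.Walk x v, p.length ≤ k + 1 ∧ (v ≠ x + (k + 1 : ℕ) → p.length ≤ k) := by
  have hlt : (v - x).val < 2 * k + 2 := ZMod.val_lt _
  have hcast : (((v - x).val : ℕ) : ZMod (2 * k + 2)) = v - x := ZMod.natCast_zmod_val _
  generalize (v - x).val = m at hlt hcast
  by_cases hm : m ≤ k + 1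
  · have hv : v = x + m := by rw [hcast]; ring
    obtain ⟨p, hp⟩ := exists_walk_add hG x m
    subst hv
    refine ⟨p, by omega, fun hne => ?_⟩
    have : m ≠ k + 1 := by rintro rfl; exact hne rfl
    omega
  · have hx : x = v + (2 * k + 2 - m : ℕ) := by
      rw [Nat.cast_sub hlt.le, ZMod.natCast_self, hcast]; ring
    obtain ⟨p, hp⟩ := exists_walk_add hG v (2 * k + 2 - m)
    refine ⟨(p.copy rfl hx.symm).reverse, ?_, fun _ => ?_⟩ <;>
      rw [Walk.length_reverse, Walk.length_copy] <;> omega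

/-- In the cycle graph on `2 * k + 2` vertices, a ball of radius `k + 1` is everything. -/
theorem gball_succ_eq_univ (k : ℕ) {G : SimpleGraph (ZMod (2 * k + 2))}
    (hG : ∀ i, G.Adj i (i + 1)) (x : ZMod (2 * k + 2)) :
    gball G x (k + 1) = Set.univ := by
  refine Set.eq_univ_of_forall fun v => ?_
  obtain ⟨p, hp, -⟩ := exists_walk_length_le k hG x v
  exact (dist_le p).trans hp

/-- In the cycle graph on `2 * k + 2` vertices, a ball of radius `k` misses exactly the antipode
of its center. -/
theorem gball_eq_compl_singleton (k : ℕ) {G : SimpleGraph (ZMod (2 * k + 2))}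
    (hAdj : ∀ i j, G.Adj i j ↔ (j = i + 1 ∨ i = j + 1)) (x : ZMod (2 * k + 2)) :
    gball G x k = {x + ((k + 1 : ℕ) : ZMod (2 * k + 2))}ᶜ := by
  have hG : ∀ i, G.Adj i (i + 1) := fun i => (hAdj _ _).2 (Or.inl rfl)
  ext v
  obtain ⟨p, -, hp⟩ := exists_walk_length_le k hG x v
  refine ⟨?_, fun hv => (dist_le p).trans (hp hv)⟩
  rintro (hd : G.dist x v ≤ k) (rfl : v = _)
  obtain ⟨q, hq⟩ := p.reachable.exists_walk_length_eq_dist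
  obtain ⟨z, hz, hzv⟩ := exists_int_of_walk (fun i j => (hAdj i j).1) q
  have h : (((k + 1 : ℕ) : ℤ) : ZMod (2 * k + 2)) = z := by
    rw [Int.cast_natCast]; exact add_left_cancel hzv
  rw [ZMod.intCast_eq_intCast_iff_dvd_sub] at h
  obtain ⟨c, hc⟩ := h
  push_cast at hc
  have h1 : c < 0 := by by_contra! h0; nlinarith [show z ≤ k by omega]
  have h2 : -1 < c := by by_contra! h0; nlinarith [show -(k : ℤ) ≤ z by omega]
  omega

/-- Let `k ≥ 1` and let `G` be the cycle graph on `n = 2k + 2 ≥ 4` vertices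
(vertex set `ℤ/nℤ`, with `i` adjacent to `i ± 1`). Then `B(G)` does not admit a
positive non-clashing teaching map of size at most `k`; consequently, the families of
balls of cycles do not admit NCTM⁺s of constant size. -/
theorem stmt9 (k : ℕ) (hk : 1 ≤ k) (G : SimpleGraph (ZMod (2 * k + 2)))
    (hAdj : ∀ i j : ZMod (2 * k + 2), G.Adj i j ↔ (j = i + 1 ∨ i = j + 1)) :
    ¬ ∃ T : Set (ZMod (2 * k + 2)) → Finset (ZMod (2 * k + 2)),
        IsPosNCTM (gballs G) T ∧ ∀ C ∈ gballs G, (T C).card ≤ k := by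
  rintro ⟨T, ⟨hsub, hclash⟩, hcard⟩
  have hG : ∀ i, G.Adj i (i + 1) := fun i => (hAdj _ _).2 (Or.inl rfl)
  have huniv : Set.univ ∈ gballs G := ⟨0, k + 1, (gball_succ_eq_univ k hG 0).symm⟩
  have hmem : ∀ y, y ∈ T Set.univ := by
    intro y
    have hy : ({y}ᶜ : Set (ZMod (2 * k + 2))) ∈ gballs G :=
      ⟨y - (k + 1 : ℕ), k, by rw [gball_eq_compl_singleton k hAdj, sub_add_cancel]⟩
    obtain ⟨q, hq, hx⟩ := hclash _ huniv _ hy fun h =>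
      (h.subset (Set.mem_univ y) : y ∈ ({y}ᶜ : Set _)) rfl
    have hqy : q = y := hx.elim (fun h => not_not.1 h.2) fun h => absurd (Set.mem_univ q) h.2
    subst hqy
    rcases Finset.mem_union.1 hq with h | h
    · exact h
    · exact absurd rfl (hsub _ hy h)
  have hle := hcard _ huniv
  rw [Finset.eq_univ_iff_forall.2 hmem, Finset.card_univ, ZMod.card] at hle
  omega
end

section
/- Let n ≥ 3 and let C_n be the cycle graph on vertex set ℤ/nℤ. The teaching map T defined on the distinct balls of C_n by: T⁺(B) = T⁻(B) = ∅ if B = V(C_n), and, for a proper ball B = B_r(x) ⊊ V(C_n), T⁺(B) = {x − r} (the first vertex of the arc B in the counterclockwise order) and T⁻(B) = {x + r + 1} (the first vertex outside B following B counterclockwise), is a non-clashing teaching map of size 2 for B(C_n). Consequently NCTD(B(C_n)) ≤ 2. -/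
open SimpleGraph

/-- The graph `G` is the cycle on `ZMod n`, with `i` adjacent to `i ± 1`. -/
def IsZModCycle {n : ℕ} (G : SimpleGraph (ZMod n)) : Prop :=
  ∀ i j : ZMod n, G.Adj i j ↔ (j = i + 1 ∨ i = j + 1)

namespace IsZModCycle

variable {n : ℕ} {G : SimpleGraph (ZMod n)}

theorem exists_walk_add (hG : IsZModCycle G) (x : ZMod n) (m : ℕ) :
    ∃ p : G.Walk x (x + m), p.length = m := by
  induction m with
  | zero => exact ⟨SimpleGraph.Walk.nil.copy rfl (by simp), by simp⟩
  | succ m ih =>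
    obtain ⟨p, hp⟩ := ih
    have h : G.Adj (x + m) (x + (m + 1 : ℕ)) :=
      (hG _ _).2 (Or.inl (by push_cast; ring))
    exact ⟨p.concat h, by simp [hp]⟩

theorem connected [NeZero n] (hG : IsZModCycle G) : G.Connected := by
  refine ⟨fun x y => ?_⟩
  obtain ⟨p, -⟩ := hG.exists_walk_add x (y - x).val
  exact ⟨p.copy rfl (by simp)⟩

theorem exists_eq_add_of_walk (hG : IsZModCycle G) {x y : ZMod n} (p : G.Walk x y) :
    ∃ j : ℤ, |j| ≤ p.length ∧ y = x + j := by
  induction p with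
  | nil => exact ⟨0, by simp⟩
  | cons h p ih =>
    obtain ⟨j, hj, rfl⟩ := ih
    rw [abs_le] at hj
    rcases (hG _ _).1 h with rfl | rfl
    · refine ⟨j + 1, ?_, by push_cast; ring⟩
      rw [abs_le, SimpleGraph.Walk.length_cons]
      push_cast
      constructor <;> linarith [hj.1, hj.2]
    · refine ⟨j - 1, ?_, by push_cast; ring⟩
      rw [abs_le, SimpleGraph.Walk.length_cons]
      push_cast
      constructor <;> linarith [hj.1, hj.2]

/-- A ball of radius `r` is the arc of `2 * r + 1` vertices (or everything) starting at `x - r`. -/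
theorem mem_gball_iff [NeZero n] (hG : IsZModCycle G) {x v : ZMod n} {r : ℕ} :
    v ∈ gball G x r ↔ (v - (x - r)).val ≤ 2 * r := by
  constructor
  · intro hv
    obtain ⟨p, hp⟩ := hG.connected.exists_walk_length_eq_dist x v
    obtain ⟨j, hj, rfl⟩ := hG.exists_eq_add_of_walk p
    have hpr : p.length ≤ r := hp.trans_le hv
    rw [abs_le] at hj
    obtain ⟨k, hk⟩ := Int.eq_ofNat_of_zero_le (show 0 ≤ j + r by omega)
    have h : x + (j : ZMod n) - (x - r) = (k : ZMod n) := by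
      have := congrArg (Int.cast : ℤ → ZMod n) hk
      push_cast at this
      rw [← this]
      ring
    rw [h, ZMod.val_natCast]
    exact (Nat.mod_le _ _).trans (by omega)
  · intro hv
    obtain ⟨k, hk⟩ : ∃ k, k = (v - (x - r)).val := ⟨_, rfl⟩
    have hvk : v = x - r + k := by simp [hk]
    rw [← hk] at hv
    show G.dist x v ≤ r
    rcases le_total r k with h | h
    · obtain ⟨m, rfl⟩ := Nat.exists_eq_add_of_le h
      obtain ⟨p, hp⟩ := hG.exists_walk_add x m
      have hv' : v = x + m := by rw [hvk]; push_cast; ring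
      rw [hv']
      exact (SimpleGraph.dist_le p).trans (by omega)
    · obtain ⟨m, rfl⟩ := Nat.exists_eq_add_of_le h
      obtain ⟨p, hp⟩ := hG.exists_walk_add v m
      have hx : x = v + m := by rw [hvk]; push_cast; ring
      rw [SimpleGraph.dist_comm, hx]
      exact (SimpleGraph.dist_le p).trans (by omega)

theorem two_mul_add_one_lt_of_gball_ne_univ [NeZero n] (hG : IsZModCycle G) {x : ZMod n} {r : ℕ}
    (h : gball G x r ≠ Set.univ) : 2 * r + 1 < n := by
  by_contra! hr
  refine h (Set.eq_univ_of_forall fun v => hG.mem_gball_iff.2 ?_)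
  have := ZMod.val_lt (v - (x - (r : ZMod n)))
  omega

theorem sub_mem_gball [NeZero n] (hG : IsZModCycle G) (x : ZMod n) (r : ℕ) :
    x - r ∈ gball G x r := by
  simp [hG.mem_gball_iff]

theorem add_add_one_notMem_gball [NeZero n] (hG : IsZModCycle G) {x : ZMod n} {r : ℕ}
    (h : gball G x r ≠ Set.univ) : x + r + 1 ∉ gball G x r := by
  have hr := hG.two_mul_add_one_lt_of_gball_ne_univ h
  have e : x + r + 1 - (x - r) = ((2 * r + 1 : ℕ) : ZMod n) := by push_cast; ring
  rw [hG.mem_gball_iff, e, ZMod.val_natCast_of_lt hr]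
  omega

/-- If two proper balls contain each other's first vertex and avoid each other's first following
vertex, then they are equal. -/
theorem gball_eq_of_clash [NeZero n] (hG : IsZModCycle G) {x x' : ZMod n} {r r' : ℕ}
    (h : gball G x r ≠ Set.univ) (h' : gball G x' r' ≠ Set.univ)
    (hp : x - r ∈ gball G x' r') (hp' : x' - r' ∈ gball G x r)
    (hq : x + r + 1 ∉ gball G x' r') (hq' : x' + r' + 1 ∉ gball G x r) :
    gball G x r = gball G x' r' := by
  have hr := hG.two_mul_add_one_lt_of_gball_ne_univ h
  have hr' := hG.two_mul_add_one_lt_of_gball_ne_univ h'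
  rw [hG.mem_gball_iff] at hp hp' hq hq'
  have key : ∀ (y y' : ZMod n) (s s' : ℕ), y + s + 1 - (y' - s') =
      (((y - s) - (y' - s')).val + (2 * s + 1) : ℕ) := by
    intro y y' s s'
    push_cast
    rw [ZMod.natCast_zmod_val]
    ring
  rw [key, ZMod.val_natCast] at hq hq'
  by_cases hs : (x - r) - (x' - r') = 0
  · have hs' : (x' - r') - (x - r) = 0 := by rw [← neg_sub, hs, neg_zero]
    rw [hs, ZMod.val_zero, zero_add, Nat.mod_eq_of_lt hr] at hq
    rw [hs', ZMod.val_zero, zero_add, Nat.mod_eq_of_lt hr'] at hq'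
    obtain rfl : r = r' := by omega
    ext v
    rw [hG.mem_gball_iff, hG.mem_gball_iff, sub_eq_zero.1 hs]
  · have hs0 : ((x - r) - (x' - r')).val ≠ 0 := by rwa [Ne, ZMod.val_eq_zero]
    have hlt := ZMod.val_lt ((x - (r : ZMod n)) - (x' - (r' : ZMod n)))
    have hsum : ((x' - r') - (x - r)).val = n - ((x - r) - (x' - r')).val := by
      rw [← neg_sub, ZMod.neg_val, if_neg hs]
    rw [hsum] at hp'
    rw [hsum, Nat.mod_eq_sub_mod (by omega), Nat.mod_eq_of_lt (by omega)] at hq'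
    rw [Nat.mod_eq_sub_mod (by omega), Nat.mod_eq_of_lt (by omega)] at hq
    omega

end IsZModCycle

/-- Let `n ≥ 3` and let `G` be the cycle graph on `ℤ/nℤ` (with `i` adjacent to `i ± 1`).
The teaching map defined by `T⁺(B) = T⁻(B) = ∅` for `B = V(G)`, and
`T⁺(B_r(x)) = {x - r}` (the first vertex of the arc `B_r(x)`) and
`T⁻(B_r(x)) = {x + r + 1}` (the first vertex outside `B_r(x)`) for every proper ball
`B_r(x) ⊊ V(G)`, is a non-clashing teaching map of size `2` for `B(G)`.
Consequently `NCTD(B(C_n)) ≤ 2`. -/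
theorem stmt10 (n : ℕ) (hn : 3 ≤ n) (G : SimpleGraph (ZMod n))
    (hAdj : ∀ i j : ZMod n, G.Adj i j ↔ (j = i + 1 ∨ i = j + 1))
    (Tp Tn : Set (ZMod n) → Finset (ZMod n))
    (hTpUniv : Tp Set.univ = ∅) (hTnUniv : Tn Set.univ = ∅)
    (hTproper : ∀ (x : ZMod n) (r : ℕ), gball G x r ≠ Set.univ →
      Tp (gball G x r) = {x - (r : ZMod n)} ∧
      Tn (gball G x r) = {x + (r : ZMod n) + 1}) :
    (IsNCTM (gballs G) Tp Tn ∧ ∀ C ∈ gballs G, (Tp C ∪ Tn C).card ≤ 2) ∧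
    (∃ Tp' Tn' : Set (ZMod n) → Finset (ZMod n),
      IsNCTM (gballs G) Tp' Tn' ∧ ∀ C ∈ gballs G, (Tp' C ∪ Tn' C).card ≤ 2) := by
  have : NeZero n := ⟨by omega⟩
  have hG : IsZModCycle G := hAdj
  have main : IsNCTM (gballs G) Tp Tn ∧ ∀ C ∈ gballs G, (Tp C ∪ Tn C).card ≤ 2 := by
    refine ⟨⟨?_, ?_, ?_⟩, ?_⟩
    · rintro _ ⟨x, r, rfl⟩
      by_cases h : gball G x r = Set.univ
      · rw [h]
        exact Set.subset_univ _
      · simpa [(hTproper x r h).1] using hG.sub_mem_gball x r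
    · rintro _ ⟨x, r, rfl⟩ q hq
      by_cases h : gball G x r = Set.univ
      · simp [h, hTnUniv] at hq
      · rw [(hTproper x r h).2, Finset.mem_singleton] at hq
        exact hq ▸ hG.add_add_one_notMem_gball h
    · rintro _ ⟨x, r, rfl⟩ _ ⟨x', r', rfl⟩ hne
      by_cases h : gball G x r = Set.univ
      · have h' : gball G x' r' ≠ Set.univ := fun h' => hne (h.trans h'.symm)
        refine ⟨x' + r' + 1, by simp [(hTproper x' r' h').2], Or.inl ⟨?_, ?_⟩⟩
        · rw [h]
          exact Set.mem_univ _
        · exact hG.add_add_one_notMem_gball h'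
      by_cases h' : gball G x' r' = Set.univ
      · refine ⟨x + r + 1, by simp [(hTproper x r h).2], Or.inr ⟨?_, ?_⟩⟩
        · rw [h']
          exact Set.mem_univ _
        · exact hG.add_add_one_notMem_gball h
      obtain ⟨hp, hq⟩ := hTproper x r h
      obtain ⟨hp', hq'⟩ := hTproper x' r' h'
      rw [hp, hq, hp', hq']
      by_contra! hc
      refine hne (hG.gball_eq_of_clash h h' ?_ ?_ ?_ ?_)
      · by_contra hx
        exact hc _ (by simp) (Or.inl ⟨hG.sub_mem_gball x r, hx⟩)
      · by_contra hx
        exact hc _ (by simp) (Or.inr ⟨hG.sub_mem_gball x' r', hx⟩)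
      · intro hx
        exact hc _ (by simp) (Or.inr ⟨hx, hG.add_add_one_notMem_gball h⟩)
      · intro hx
        exact hc _ (by simp) (Or.inl ⟨hx, hG.add_add_one_notMem_gball h'⟩)
    · rintro _ ⟨x, r, rfl⟩
      by_cases h : gball G x r = Set.univ
      · simp [h, hTpUniv, hTnUniv]
      · rw [(hTproper x r h).1, (hTproper x r h).2]
        exact Finset.card_le_two
  exact ⟨main, Tp, Tn, main⟩
end

section
/- Let K be a finite tree of cycles (cactus) and let x, u, v be vertices of K. Then there exists a unique vertex y ∈ I(x,u) ∩ I(x,v) such that I(x,y') ⊆ I(x,y) for every y' ∈ I(x,u) ∩ I(x,v); this vertex y is the (unique) apex of x with respect to u and v. -/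
open SimpleGraph

/-- A tree of cycles (cactus): a finite connected graph in which every edge belongs to
at most one cycle, formalized as: any two cycles sharing an edge have the same edge set. -/
def IsCactus {V : Type*} [DecidableEq V] (G : SimpleGraph V) : Prop :=
  G.Connected ∧ ∀ (u v : V) (c₁ : G.Walk u u) (c₂ : G.Walk v v),
    c₁.IsCycle → c₂.IsCycle → ∀ e ∈ c₁.edges, e ∈ c₂.edges →
      c₁.edges.toFinset = c₂.edges.toFinset

/-- The interval `I(u, v)`: vertices lying on shortest `u`–`v` paths. -/
def ginterval {V : Type*} (G : SimpleGraph V) (u v : V) : Set V :=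
  {w | G.dist u w + G.dist w v = G.dist u v}

/-- The order on the vertices of a connected graph based at `x`: `a ≤ b` iff `a ∈ I(x, b)`. -/
abbrev basedOrder {V : Type*} {G : SimpleGraph V} (hG : G.Connected) (x : V) :
    PartialOrder V where
  le a b := a ∈ ginterval G x b
  le_refl a := by simp [ginterval]
  le_trans a b c hab hbc := by
    simp only [ginterval, Set.mem_ofPred_eq] at *
    have h₁ := hG.dist_triangle (u := a) (v := b) (w := c)
    have h₂ := hG.dist_triangle (u := x) (v := a) (w := c)
    omega
  le_antisymm a b hab hba := by
    simp only [ginterval, Set.mem_ofPred_eq] at *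
    exact hG.dist_eq_zero_iff.1 (by omega)

/-- If `a ∈ I(x, b)`, some walk from `a` to `b` stays between `a` and `b` as seen from `x`. -/
theorem exists_walk_between {V : Type*} [DecidableEq V] {G : SimpleGraph V} (hG : G.Connected)
    {x a b : V} (hab : a ∈ ginterval G x b) :
    ∃ p : G.Walk a b, ∀ w ∈ p.support, a ∈ ginterval G x w ∧ w ∈ ginterval G x b := by
  obtain ⟨p, hp⟩ := hG.exists_walk_length_eq_dist a b
  refine ⟨p, fun w hw ↦ ?_⟩
  have hlen := congrArg Walk.length (p.take_spec hw)
  rw [Walk.length_append] at hlen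
  have h₁ := dist_le (p.takeUntil w hw)
  have h₂ := dist_le (p.dropUntil w hw)
  have h₃ := hG.dist_triangle (u := x) (v := a) (w := w)
  have h₄ := hG.dist_triangle (u := x) (v := w) (w := b)
  simp only [ginterval, Set.mem_ofPred_eq] at *
  omega

/-- Two walks to a common end, neither containing the start of the other, yield a path between
their starts which avoids the edge joining these starts. -/
theorem exists_isPath_of_walks {V : Type*} [DecidableEq V] {G : SimpleGraph V} {a b c : V}
    (p : G.Walk a c) (q : G.Walk b c) (hb : b ∉ p.support) (ha : a ∉ q.support) :
    ∃ r : G.Walk a b, r.IsPath ∧ (∀ w ∈ r.support, w ∈ p.support ∨ w ∈ q.support) ∧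
      s(a, b) ∉ r.edges := by
  refine ⟨(p.append q.reverse).bypass, Walk.bypass_isPath _, fun w hw ↦ ?_, fun he ↦ ?_⟩
  · simpa [Walk.mem_support_append_iff] using Walk.support_bypass_subset_support _ hw
  · have := Walk.edges_bypass_subset_edges _ he
    rw [Walk.edges_append, Walk.edges_reverse, List.mem_append, List.mem_reverse] at this
    rcases this with h | h
    · exact hb (p.snd_mem_support_of_mem_edges h)
    · exact ha (q.fst_mem_support_of_mem_edges h)

/-- Paths with the same ends which share no further vertex share at most the edge joining the
ends. -/
theorem disjoint_edges_of_support {V : Type*} {G : SimpleGraph V} {a b : V} {p q : G.Walk a b}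
    (hpe : s(a, b) ∉ p.edges) (hpq : ∀ w ∈ p.support, w ∈ q.support → w = a ∨ w = b) :
    p.edges.Disjoint q.edges := by
  intro e hep heq
  induction e with
  | h v w =>
    have hvw := (p.adj_of_mem_edges hep).ne
    have hv := hpq v (p.fst_mem_support_of_mem_edges hep) (q.fst_mem_support_of_mem_edges heq)
    have hw := hpq w (p.snd_mem_support_of_mem_edges hep) (q.snd_mem_support_of_mem_edges heq)
    rcases hv with rfl | rfl <;> rcases hw with rfl | rfl
    · exact hvw rfl
    · exact hpe hep
    · exact hpe (Sym2.eq_swap ▸ hep)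
    · exact hvw rfl

/-- Two internally disjoint paths with the same distinct ends form a cycle. -/
theorem isCycle_append_reverse {V : Type*} {G : SimpleGraph V} {a b : V} {p q : G.Walk a b}
    (hab : a ≠ b) (hp : p.IsPath) (hq : q.IsPath) (hpe : s(a, b) ∉ p.edges)
    (hpq : ∀ w ∈ p.support, w ∈ q.support → w = a ∨ w = b) :
    (p.append q.reverse).IsCycle := by
  refine hp.isCycle_append hq.reverse (fun w hw hw' ↦ ?_) (.inl ?_)
  · have hps := hp.support_nodup
    have hqs := hq.reverse.support_nodup
    rw [← Walk.cons_tail_support] at hps hqs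
    have hwq : w ∈ q.support := by simpa using List.mem_of_mem_tail hw'
    rcases hpq w (List.mem_of_mem_tail hw) hwq with rfl | rfl
    · exact (List.nodup_cons.1 hps).1 hw
    · exact (List.nodup_cons.1 hqs).1 hw'
  · cases p with
    | nil => exact absurd rfl hab
    | cons h t =>
      cases t with
      | nil => exact absurd List.mem_cons_self hpe
      | cons h' t' => simp

/-- A cactus contains no three internally disjoint paths with the same distinct ends. -/
theorem IsCactus.not_theta {V : Type*} [DecidableEq V] {G : SimpleGraph V} (hG : IsCactus G)
    {a b : V} {p q r : G.Walk a b} (hab : a ≠ b) (hp : p.IsPath) (hq : q.IsPath) (hr : r.IsPath)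
    (hpe : s(a, b) ∉ p.edges) (hqe : s(a, b) ∉ q.edges)
    (hpq : ∀ w ∈ p.support, w ∈ q.support → w = a ∨ w = b)
    (hpr : ∀ w ∈ p.support, w ∈ r.support → w = a ∨ w = b)
    (hqr : ∀ w ∈ q.support, w ∈ r.support → w = a ∨ w = b) : False := by
  have exists_edge {s : G.Walk a b} : ∃ e, e ∈ s.edges := by
    cases s with
    | nil => exact absurd rfl hab
    | cons h t => exact ⟨_, List.mem_cons_self⟩
  obtain ⟨e, he⟩ := exists_edge (s := p)
  obtain ⟨f, hf⟩ := exists_edge (s := q)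
  have heq := hG.2 a a _ _ (isCycle_append_reverse hab hp hq hpe hpq)
    (isCycle_append_reverse hab hp hr hpe hpr) e (by simp [he]) (by simp [he])
  have hmem : f ∈ (p.append r.reverse).edges.toFinset := heq ▸ by simp [hf]
  simp only [Walk.edges_append, Walk.edges_reverse, List.mem_toFinset, List.mem_append,
    List.mem_reverse] at hmem
  rcases hmem with h | h
  · exact disjoint_edges_of_support hpe hpq h hf
  · exact disjoint_edges_of_support hqe hqr hf h

/-- In the order of a cactus based at `x`, maximal common lower bounds are unique. -/
theorem IsCactus.eq_of_maximal {V : Type*} [DecidableEq V] {G : SimpleGraph V}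
    (hG : IsCactus G) {x u v a b : V}
    (ha : @Maximal V (basedOrder hG.1 x).toLE (· ∈ ginterval G x u ∩ ginterval G x v) a)
    (hb : @Maximal V (basedOrder hG.1 x).toLE (· ∈ ginterval G x u ∩ ginterval G x v) b) :
    a = b := by
  let := basedOrder hG.1 x
  by_contra hne
  have hab : ¬ a ≤ b := fun h ↦ hne (ha.eq_of_le hb.prop h)
  have hba : ¬ b ≤ a := fun h ↦ hne (hb.eq_of_le ha.prop h).symm
  have exists_upper {c : V} (hac : a ≤ c) (hbc : b ≤ c) : ∃ r : G.Walk a b, r.IsPath ∧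
      (∀ w ∈ r.support, w ≤ c ∧ (a ≤ w ∨ b ≤ w)) ∧ s(a, b) ∉ r.edges := by
    obtain ⟨p, hp⟩ := exists_walk_between hG.1 hac
    obtain ⟨q, hq⟩ := exists_walk_between hG.1 hbc
    obtain ⟨r, hr, hrs, hre⟩ := exists_isPath_of_walks p q (fun h ↦ hab (hp b h).1)
      (fun h ↦ hba (hq a h).1)
    refine ⟨r, hr, fun w hw ↦ ?_, hre⟩
    rcases hrs w hw with h | h
    · exact ⟨(hp w h).2, .inl (hp w h).1⟩
    · exact ⟨(hq w h).2, .inr (hq w h).1⟩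
  have hx (c : V) : x ≤ c := by
    change x ∈ ginterval G x c
    simp [ginterval]
  obtain ⟨p, hp, hps, hpe⟩ := exists_upper ha.prop.1 hb.prop.1
  obtain ⟨q, hq, hqs, hqe⟩ := exists_upper ha.prop.2 hb.prop.2
  obtain ⟨r, hr, hrs⟩ : ∃ r : G.Walk a b, r.IsPath ∧ ∀ w ∈ r.support, w ≤ a ∨ w ≤ b := by
    obtain ⟨s, hs⟩ := exists_walk_between hG.1 (hx a)
    obtain ⟨t, ht⟩ := exists_walk_between hG.1 (hx b)
    obtain ⟨r, hr, hrs, -⟩ := exists_isPath_of_walks s.reverse t.reverse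
      (fun h ↦ hba (hs b (by simpa using h)).2) (fun h ↦ hab (ht a (by simpa using h)).2)
    refine ⟨r, hr, fun w hw ↦ (hrs w hw).imp (fun h ↦ ?_) fun h ↦ ?_⟩
    · exact (hs w (by simpa using h)).2
    · exact (ht w (by simpa using h)).2
  have eq_or_eq {w : V} (h₁ : a ≤ w ∨ b ≤ w) (h₂ : w ≤ a ∨ w ≤ b) : w = a ∨ w = b := by
    rcases h₁ with h₁ | h₁ <;> rcases h₂ with h₂ | h₂
    · exact .inl (le_antisymm h₂ h₁)
    · exact absurd (h₁.trans h₂) hab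
    · exact absurd (h₁.trans h₂) hba
    · exact .inr (le_antisymm h₂ h₁)
  refine hG.not_theta hne hp hq hr hpe hqe (fun w h h' ↦ ?_)
    (fun w h h' ↦ eq_or_eq (hps w h).2 (hrs w h')) fun w h h' ↦ eq_or_eq (hqs w h).2 (hrs w h')
  have hw : w ∈ ginterval G x u ∩ ginterval G x v := ⟨(hps w h).1, (hqs w h').1⟩
  exact (hps w h).2.imp (fun h ↦ (ha.eq_of_le hw h).symm) fun h ↦ (hb.eq_of_le hw h).symm

/-- In a finite tree of cycles `K`, for any vertices `x, u, v` there is a unique vertex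
`y ∈ I(x,u) ∩ I(x,v)` such that `I(x,y') ⊆ I(x,y)` for every
`y' ∈ I(x,u) ∩ I(x,v)`; this `y` is the unique apex of `x` with respect to `u, v`. -/
theorem stmt12 {V : Type*} [Fintype V] [DecidableEq V] (G : SimpleGraph V)
    (hG : IsCactus G) (x u v : V) :
    ∃! y : V, y ∈ ginterval G x u ∩ ginterval G x v ∧
      ∀ y' ∈ ginterval G x u ∩ ginterval G x v,
        ginterval G x y' ⊆ ginterval G x y := by
  let := basedOrder hG.1 x
  have hfin := (ginterval G x u ∩ ginterval G x v).toFinite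
  have hx : x ∈ ginterval G x u ∩ ginterval G x v := by simp [ginterval]
  obtain ⟨y, -, hy⟩ := hfin.exists_le_maximal hx
  refine ⟨y, ⟨hy.prop, fun y' hy' w (hw : w ≤ y') ↦ ?_⟩, fun z ⟨hz, hzmax⟩ ↦ ?_⟩
  · obtain ⟨z, hyz, hz⟩ := hfin.exists_le_maximal hy'
    exact hw.trans (hG.eq_of_maximal hz hy ▸ hyz)
  · exact (hy.eq_of_le hz (hzmax y hy.prop (le_refl y))).symm
end

section
/- Let K be a finite tree of cycles (cactus) and let C ⊆ V(K) be the vertex set of a cycle of K. Then C is gated: for every vertex u of K there exists u' ∈ C such that d(u,v) = d(u,u') + d(u',v) for every v ∈ C. -/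
open SimpleGraph

namespace SimpleGraph.Walk

variable {V : Type*} {G : SimpleGraph V}

/-- A walk ending in `C` splits at its first vertex in `C`. -/
lemma exists_append_first_mem {C : Set V} {u v : V} (p : G.Walk u v) (hv : v ∈ C) :
    ∃ w ∈ C, ∃ (q : G.Walk u w) (r : G.Walk w v), p = q.append r ∧
      (∀ x ∈ q.support, x ∈ C → x = w) ∧ ∀ e ∈ q.edges, ∃ x ∈ e, x ∉ C := by
  induction p with
  | nil => exact ⟨_, hv, nil, nil, by simp⟩
  | @cons a b _ h p ih =>
    by_cases ha : a ∈ C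
    · exact ⟨a, ha, nil, cons h p, by simp⟩
    · obtain ⟨w, hw, q, r, rfl, hs, he⟩ := ih hv
      refine ⟨w, hw, cons h q, r, rfl, ?_, ?_⟩
      · rintro x hx hxC
        rw [support_cons, List.mem_cons] at hx
        rcases hx with rfl | hx
        · exact absurd hxC ha
        · exact hs x hx hxC
      · intro e hx
        rw [edges_cons, List.mem_cons] at hx
        rcases hx with rfl | hx
        · exact ⟨a, by simp, ha⟩
        · exact he e hx

/-- The concatenation of two paths meeting only at their common endpoint is a path. -/
lemma IsPath.append_of_inter {u v w : V} {p : G.Walk u v} {q : G.Walk v w}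
    (hp : p.IsPath) (hq : q.IsPath) (h : ∀ x ∈ p.support, x ∈ q.support → x = v) :
    (p.append q).IsPath := by
  have hqn := hq.support_nodup
  rw [← cons_tail_support, List.nodup_cons] at hqn
  rw [isPath_def, support_append, List.nodup_append']
  refine ⟨hp.support_nodup, hqn.2, fun x hx hx' => hqn.1 ?_⟩
  exact h x hx (List.mem_of_mem_tail hx') ▸ hx'

end SimpleGraph.Walk

/-- In a cactus, the endpoints of a path that meets a cycle only in its endpoints and
uses none of its edges coincide. -/
lemma IsCactus.eq_of_isPath {V : Type*} [DecidableEq V] {G : SimpleGraph V} (hG : IsCactus G)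
    {w a b : V} {c : G.Walk w w} (hc : c.IsCycle) (ha : a ∈ c.support) (hb : b ∈ c.support)
    {p : G.Walk a b} (hp : p.IsPath) (hs : ∀ x ∈ p.support, x ∈ c.support → x = a ∨ x = b)
    (he : ∀ e ∈ p.edges, e ∉ c.edges) : a = b := by
  by_contra hab
  have hbc : (c.rotate b hb).IsCycle := hc.rotate hb
  have ha' : a ∈ (c.rotate b hb).support := by
    rwa [Walk.mem_support_rotate_iff]
  have hqp := hbc.isPath_takeUntil ha'
  have hqe : ∀ e ∈ ((c.rotate b hb).takeUntil a ha').edges, e ∈ c.edges := fun e h =>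
    (c.rotate_edges b hb).mem_iff.1 (Walk.edges_takeUntil_subset_edges _ ha' h)
  have hqs : ∀ x ∈ ((c.rotate b hb).takeUntil a ha').support, x ∈ c.support := fun x h =>
    (Walk.mem_support_rotate_iff ..).1 (Walk.support_takeUntil_subset_support _ ha' h)
  generalize (c.rotate b hb).takeUntil a ha' = q at hqp hqe hqs
  cases p with
  | nil => exact hab rfl
  | @cons _ x _ h p =>
    rw [Walk.cons_isPath_iff] at hp
    have hpq : (p.append q).IsPath := hp.1.append_of_inter hqp fun y hy hy' =>
      (hs y (by simp [hy]) (hqs y hy')).resolve_left fun hya => hp.2 (hya ▸ hy)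
    have hax : s(a, x) ∉ c.edges := he _ (by simp)
    have hcyc : ((p.append q).cons h).IsCycle := by
      rw [Walk.cons_isCycle_iff]
      refine ⟨hpq, fun hmem => ?_⟩
      rw [Walk.edges_append, List.mem_append] at hmem
      rcases hmem with hmem | hmem
      · exact hp.2 (p.fst_mem_support_of_mem_edges hmem)
      · exact hax (hqe _ hmem)
    obtain ⟨e, heq⟩ : ∃ e, e ∈ q.edges := by
      cases q with
      | nil => exact absurd rfl hab
      | cons h' q => exact ⟨_, List.mem_cons_self⟩
    have := hG.2 _ _ _ _ hcyc hc e (by simp [heq]) (hqe e heq)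
    apply hax
    rw [← List.mem_toFinset, ← this]
    simp

/-- In a finite tree of cycles `K`, the vertex set `C` of any cycle of `K` is gated:
for every vertex `u` there is a gate `u' ∈ C` with `d(u,v) = d(u,u') + d(u',v)` for
every `v ∈ C`. -/
theorem stmt13 {V : Type*} [Fintype V] [DecidableEq V] (G : SimpleGraph V)
    (hG : IsCactus G) (C : Set V)
    (hC : ∃ (w : V) (c : G.Walk w w), c.IsCycle ∧ C = {v | v ∈ c.support}) :
    ∀ u : V, ∃ u' ∈ C, ∀ v ∈ C, G.dist u v = G.dist u u' + G.dist u' v := by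
  obtain ⟨w, c, hc, rfl⟩ := hC
  intro u
  obtain ⟨p₀⟩ := hG.1 u w
  obtain ⟨u', hu', q, -, -, hqs, hqe⟩ :=
    p₀.exists_append_first_mem (C := {v | v ∈ c.support}) c.start_mem_support
  refine ⟨u', hu', fun v hv => ?_⟩
  obtain ⟨p, hp⟩ := hG.1.exists_walk_length_eq_dist u v
  obtain ⟨v', hv', q', r, rfl, hqs', hqe'⟩ := p.exists_append_first_mem hv
  have huv : u' = v' := by
    refine hG.eq_of_isPath hc hu' hv' (q.reverse.append q').bypass_isPath ?_ ?_
    · intro x hx hxc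
      have hx := Walk.support_bypass_subset_support _ hx
      rw [Walk.mem_support_append_iff, Walk.support_reverse, List.mem_reverse] at hx
      exact hx.imp (hqs x · hxc) (hqs' x · hxc)
    · intro e he hec
      have he := Walk.edges_bypass_subset_edges _ he
      rw [Walk.edges_append, Walk.edges_reverse, List.mem_append, List.mem_reverse] at he
      obtain ⟨x, hxe, hxc⟩ := he.elim (hqe e) (hqe' e)
      exact hxc (c.mem_support_of_mem_edges hec hxe)
  subst huv
  refine le_antisymm hG.1.dist_triangle ?_
  rw [← hp, Walk.length_append]
  exact add_le_add (dist_le _) (dist_le _)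
end

section
/- Let K be a finite tree of cycles (cactus), let B_r(x) be a ball of K, let {u,v} be a diametral pair of B_r(x), let x' be the apex of x with respect to u and v, and set r' = r − d(x,x') (note d(x,x') ≤ d(x,u) ≤ r). Then B_{r'}(x') = B_r(x). -/
open SimpleGraph

/-- A walk avoiding `p` between two neighbours `s ≠ t` of `p` closes up to a cycle at `p` whose only
edges at `p` are `ps` and `pt`. -/
lemma SimpleGraph.exists_isCycle_of_walk_avoiding {V : Type*} [DecidableEq V] {G : SimpleGraph V}
    {p s t : V} (hs : G.Adj p s) (ht : G.Adj p t) (hst : s ≠ t) (q : G.Walk s t)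
    (hq : p ∉ q.support) :
    ∃ c : G.Walk p p, c.IsCycle ∧ ∀ w, s(p, w) ∈ c.edges ↔ w = s ∨ w = t := by
  have hq' : p ∉ q.bypass.support := fun h => hq (q.support_bypass_subset_support h)
  have hpe : ∀ w, s(p, w) ∉ q.bypass.edges :=
    fun w h => hq' (q.bypass.fst_mem_support_of_mem_edges h)
  refine ⟨Walk.cons hs (q.bypass.concat ht.symm), ?_, fun w => ?_⟩
  · rw [Walk.cons_isCycle_iff]
    refine ⟨q.bypass_isPath.concat hq' ht.symm, ?_⟩
    have := hs.ne
    have := ht.ne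
    simp only [Walk.edges_concat, List.concat_eq_append, List.mem_append, List.mem_singleton,
      not_or, Sym2.eq_iff]
    exact ⟨hpe s, by tauto⟩
  · have := hs.ne
    have := ht.ne
    simp only [Walk.edges_cons, Walk.edges_concat, List.concat_eq_append, List.mem_cons,
      List.mem_append, List.not_mem_nil, or_false, Sym2.eq_iff, hpe w, false_or]
    grind

/-- In a cactus, removing a vertex `p` cannot leave three neighbours of `p` connected. -/
lemma IsCactus.not_walk_avoiding {V : Type*} [DecidableEq V] {G : SimpleGraph V}
    (hG : IsCactus G) {p s t w : V} (hs : G.Adj p s) (ht : G.Adj p t) (hw : G.Adj p w)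
    (hst : s ≠ t) (hsw : s ≠ w) (htw : t ≠ w) (q₁ : G.Walk s t) (hq₁ : p ∉ q₁.support)
    (q₂ : G.Walk s w) : p ∈ q₂.support := by
  by_contra hq₂
  obtain ⟨c₁, hc₁, h₁⟩ := exists_isCycle_of_walk_avoiding hs ht hst q₁ hq₁
  obtain ⟨c₂, hc₂, h₂⟩ := exists_isCycle_of_walk_avoiding hs hw hsw q₂ hq₂
  have h := hG.2 p p c₁ c₂ hc₁ hc₂ s(p, s) ((h₁ s).2 (.inl rfl)) ((h₂ s).2 (.inl rfl))
  have hmem : s(p, w) ∈ c₁.edges := by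
    rw [← List.mem_toFinset, h, List.mem_toFinset]
    exact (h₂ w).2 (.inr rfl)
  rcases (h₁ w).1 hmem with rfl | rfl
  · exact hsw rfl
  · exact htw rfl

/-- A geodesic from `p` to `x ≠ p` leaves `p` through a neighbour and never returns. -/
lemma SimpleGraph.Connected.exists_adj_walk_avoiding {V : Type*} {G : SimpleGraph V}
    (hG : G.Connected) {p x : V} (h : p ≠ x) :
    ∃ (s : V) (q : G.Walk s x), G.Adj p s ∧ p ∉ q.support ∧ G.dist s x + 1 = G.dist p x := by
  obtain ⟨c, hc, hl⟩ := hG.exists_path_of_dist p x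
  cases c with
  | nil => exact absurd rfl h
  | @cons _ s _ hs q =>
    refine ⟨s, q, hs, ((Walk.cons_isPath_iff hs q).1 hc).2, ?_⟩
    have h₁ := dist_le q
    have h₂ := hG.dist_triangle (u := p) (v := s) (w := x)
    rw [dist_eq_one_iff_adj.2 hs] at h₂
    rw [Walk.length_cons] at hl
    omega

/-- If `p` is not in the interval between `a` and `b`, then some walk from `a` to `b` avoids `p`. -/
lemma SimpleGraph.Connected.exists_walk_avoiding {V : Type*} [DecidableEq V] {G : SimpleGraph V}
    (hG : G.Connected) {p a b : V} (h : p ∉ ginterval G a b) :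
    ∃ q : G.Walk a b, p ∉ q.support := by
  obtain ⟨q, hl⟩ := hG.exists_walk_length_eq_dist a b
  refine ⟨q, fun hp => h ?_⟩
  have h₁ := dist_le (q.takeUntil p hp)
  have h₂ := dist_le (q.dropUntil p hp)
  have h₃ := congrArg Walk.length (q.take_spec hp)
  rw [Walk.length_append] at h₃
  have h₄ := hG.dist_triangle (u := a) (v := p) (w := b)
  change G.dist a p + G.dist p b = G.dist a b
  omega

/-- If `p` lies between `a` and `b`, then geodesics from `p` to `a` and to `b` share no neighbour
of `p`. -/
lemma SimpleGraph.Connected.ne_of_mem_ginterval {V : Type*} {G : SimpleGraph V}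
    (hG : G.Connected) {p a b s t : V} (h : p ∈ ginterval G a b)
    (hs : G.dist s a + 1 = G.dist p a) (ht : G.dist t b + 1 = G.dist p b) : s ≠ t := by
  rintro rfl
  have h₁ : G.dist a p + G.dist p b = G.dist a b := h
  have h₂ := hG.dist_triangle (u := a) (v := s) (w := b)
  rw [G.dist_comm (u := a) (v := p)] at h₁
  rw [G.dist_comm (u := a) (v := s)] at h₂
  omega

/-- Geodesics from an apex `p` of `x` with respect to `u` and `v` to `u` and to `v` share no
neighbour of `p`. -/
lemma SimpleGraph.Connected.ne_of_apex {V : Type*} {G : SimpleGraph V}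
    (hG : G.Connected) {x u v p s t : V}
    (hmem : p ∈ ginterval G x u ∩ ginterval G x v)
    (hmax : ∀ y ∈ ginterval G x u ∩ ginterval G x v,
      ginterval G x p ⊆ ginterval G x y → ginterval G x y = ginterval G x p)
    (hps : G.Adj p s) (hs : G.dist s u + 1 = G.dist p u) (ht : G.dist t v + 1 = G.dist p v) :
    s ≠ t := by
  rintro rfl
  have hu : G.dist x p + G.dist p u = G.dist x u := hmem.1
  have hv : G.dist x p + G.dist p v = G.dist x v := hmem.2
  have hd := dist_eq_one_iff_adj.2 hps
  have h₁ := hG.dist_triangle (u := x) (v := p) (w := s)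
  have h₂ := hG.dist_triangle (u := x) (v := s) (w := u)
  have h₃ := hG.dist_triangle (u := x) (v := s) (w := v)
  have hsub : ginterval G x p ⊆ ginterval G x s := by
    intro w hw
    have hw' : G.dist x w + G.dist w p = G.dist x p := hw
    have h₄ := hG.dist_triangle (u := w) (v := p) (w := s)
    have h₅ := hG.dist_triangle (u := x) (v := w) (w := s)
    change G.dist x w + G.dist w s = G.dist x s
    omega
  have heq := hmax s ⟨by change _ + _ = _; omega, by change _ + _ = _; omega⟩ hsub
  have hs' : s ∈ ginterval G x s := by simp [ginterval]
  rw [heq] at hs'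
  have h₆ : G.dist x s + G.dist s p = G.dist x p := hs'
  omega

/-- In a cactus, an apex `p` of `x` with respect to `u` and `v` lies between every vertex `z` and
one of `x`, `u`, `v`. -/
lemma IsCactus.mem_ginterval_of_apex {V : Type*} [DecidableEq V] {G : SimpleGraph V}
    (hG : IsCactus G) {x u v p : V}
    (hmem : p ∈ ginterval G x u ∩ ginterval G x v)
    (hmax : ∀ y ∈ ginterval G x u ∩ ginterval G x v,
      ginterval G x p ⊆ ginterval G x y → ginterval G x y = ginterval G x p) (z : V) :
    p ∈ ginterval G x z ∨ p ∈ ginterval G u z ∨ p ∈ ginterval G v z := by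
  by_contra! h
  obtain ⟨hx, hu, hv⟩ := h
  have ne : ∀ {a}, p ∉ ginterval G a z → p ≠ a := by
    rintro a ha rfl
    exact ha (by simp [ginterval])
  obtain ⟨s, q₁, hs, hq₁, ds⟩ := hG.1.exists_adj_walk_avoiding (ne hx)
  obtain ⟨t, q₂, ht, hq₂, dt⟩ := hG.1.exists_adj_walk_avoiding (ne hu)
  obtain ⟨w, q₃, hw, hq₃, dw⟩ := hG.1.exists_adj_walk_avoiding (ne hv)
  obtain ⟨r₁, hr₁⟩ := hG.1.exists_walk_avoiding hx
  obtain ⟨r₂, hr₂⟩ := hG.1.exists_walk_avoiding hu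
  obtain ⟨r₃, hr₃⟩ := hG.1.exists_walk_avoiding hv
  have key := hG.not_walk_avoiding hs ht hw (hG.1.ne_of_mem_ginterval hmem.1 ds dt)
    (hG.1.ne_of_mem_ginterval hmem.2 ds dw) (hG.1.ne_of_apex hmem hmax ht dt dw)
    ((q₁.append r₁).append (q₂.append r₂).reverse)
    (by simp [Walk.mem_support_append_iff, hq₁, hq₂, hr₁, hr₂])
    ((q₁.append r₁).append (q₃.append r₃).reverse)
  simp [Walk.mem_support_append_iff, hq₁, hq₃, hr₁, hr₃] at key

/-- Let `K` be a finite tree of cycles, `B_r(x)` a ball of `K`, `{u, v}` a diametral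
pair of `B_r(x)`, and `x'` the apex of `x` with respect to `u` and `v` (an element of
`I(x,u) ∩ I(x,v)` with `I(x,x')` maximal w.r.t. inclusion). With `r' = r - d(x,x')`
(note `d(x,x') ≤ d(x,u) ≤ r`), we have `B_{r'}(x') = B_r(x)`. -/
theorem stmt14 {V : Type*} [Fintype V] [DecidableEq V] (G : SimpleGraph V)
    (hG : IsCactus G) (x u v x' : V) (r : ℕ)
    (hu : u ∈ gball G x r) (hv : v ∈ gball G x r)
    (hdiam : ∀ a ∈ gball G x r, ∀ b ∈ gball G x r, G.dist a b ≤ G.dist u v)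
    (hx'mem : x' ∈ ginterval G x u ∩ ginterval G x v)
    (hx'max : ∀ y' ∈ ginterval G x u ∩ ginterval G x v,
      ginterval G x x' ⊆ ginterval G x y' → ginterval G x y' = ginterval G x x') :
    gball G x' (r - G.dist x x') = gball G x r := by
  have hu' : G.dist x u ≤ r := hu
  have hv' : G.dist x v ≤ r := hv
  have hxu : G.dist x x' + G.dist x' u = G.dist x u := hx'mem.1
  have hxv : G.dist x x' + G.dist x' v = G.dist x v := hx'mem.2
  ext z
  constructor
  · intro hz
    have hz' : G.dist x' z ≤ r - G.dist x x' := hz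
    have h := hG.1.dist_triangle (u := x) (v := x') (w := z)
    change G.dist x z ≤ r
    omega
  · intro hz
    have hz' : G.dist x z ≤ r := hz
    change G.dist x' z ≤ r - G.dist x x'
    have huz := hdiam u hu z hz
    have hvz := hdiam v hv z hz
    have huv := hG.1.dist_triangle (u := u) (v := x') (w := v)
    have cu := G.dist_comm (u := u) (v := x')
    have cv := G.dist_comm (u := v) (v := x')
    rcases hG.mem_ginterval_of_apex hx'mem hx'max z with h | h | h
    all_goals
      have h' : _ + _ = _ := h
      omega
end

section
/- For every finite tree of cycles (cactus) K, the family B(K) of balls of K admits a non-clashing teaching map of size at most 4; i.e., NCTD(B(K)) ≤ 4. -/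
open SimpleGraph

namespace Cactus

/-- Distance between the positions `i` and `j` on a cycle of length `n`. -/
def cycDist (n i j : ℕ) : ℕ :=
  min (max i j - min i j) (n - (max i j - min i j))

variable {V : Type*} {G : SimpleGraph V}

/-- `E` is the edge set of a 2-connected component: a cycle or a bridge. -/
def IsBlock (G : SimpleGraph V) (E : Set (Sym2 V)) : Prop :=
  (∃ (u : V) (c : G.Walk u u), c.IsCycle ∧ E = {e | e ∈ c.edges}) ∨
    ∃ e ∈ G.edgeSet, G.IsBridge e ∧ E = {e}

/-- A closed chain `φ 0, …, φ n = φ 0` running through a block `E`, together with the gate map `π`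
sending a vertex to the index of the unique vertex of the chain it is connected to without using
the edges of `E`. A bridge is regarded as a cycle of length two. -/
structure GatedCycle (G : SimpleGraph V) (E : Set (Sym2 V)) (n : ℕ) (φ : ℕ → V) (π : V → ℕ) :
    Prop where
  two_le : 2 ≤ n
  block : IsBlock G E
  closed : φ n = φ 0
  adj : ∀ i < n, G.Adj (φ i) (φ (i + 1))
  mem_iff : ∀ e, e ∈ E ↔ ∃ i < n, e = s(φ i, φ (i + 1))
  sep : ∀ i < n, ∀ j < n, (G.deleteEdges E).Reachable (φ i) (φ j) → i = j
  gate_lt : ∀ v, π v < n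
  gate_reachable : ∀ v, (G.deleteEdges E).Reachable (φ (π v)) v

namespace GatedCycle

variable {E : Set (Sym2 V)} {n : ℕ} {φ : ℕ → V} {π : V → ℕ}

theorem gate_eq_iff (C : GatedCycle G E n φ π) {u v : V} :
    π u = π v ↔ (G.deleteEdges E).Reachable u v := by
  constructor
  · intro h
    have := C.gate_reachable u
    rw [h] at this
    exact this.symm.trans (C.gate_reachable v)
  · intro h
    exact C.sep _ (C.gate_lt u) _ (C.gate_lt v)
      (((C.gate_reachable u).trans h).trans (C.gate_reachable v).symm)

theorem gate_apply (C : GatedCycle G E n φ π) {i : ℕ} (hi : i < n) : π (φ i) = i :=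
  C.sep _ (C.gate_lt _) _ hi (C.gate_reachable _)

theorem gate_apply_le (C : GatedCycle G E n φ π) {i : ℕ} (hi : i ≤ n) :
    π (φ i) = if i = n then 0 else i := by
  split_ifs with h
  · rw [h, C.closed, C.gate_apply (by have := C.two_le; omega)]
  · exact C.gate_apply (by omega)

theorem dist_apply_le_sub (C : GatedCycle G E n φ π) (hG : G.Connected) {i j : ℕ} (hij : i ≤ j)
    (hj : j ≤ n) : G.dist (φ i) (φ j) ≤ j - i := by
  induction j, hij using Nat.le_induction with
  | base => simp
  | succ j hij ih =>
    have h1 := ih (by omega)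
    have h2 := hG.dist_triangle (u := φ i) (v := φ j) (w := φ (j + 1))
    have h3 := SimpleGraph.dist_eq_one_iff_adj.2 (C.adj j (by omega))
    omega

theorem dist_apply_le (C : GatedCycle G E n φ π) (hG : G.Connected) {i j : ℕ} (hi : i < n)
    (hj : j < n) : G.dist (φ i) (φ j) ≤ cycDist n i j := by
  wlog hij : i ≤ j generalizing i j
  · have := this hj hi (by omega)
    rw [SimpleGraph.dist_comm]
    unfold cycDist at *
    omega
  have h1 := C.dist_apply_le_sub hG hij (by omega)
  have h2 := C.dist_apply_le_sub hG (Nat.zero_le i) (by omega)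
  have h3 := C.dist_apply_le_sub hG (i := j) (j := n) (by omega) le_rfl
  rw [C.closed] at h3
  have h4 := hG.dist_triangle (u := φ i) (v := φ 0) (w := φ j)
  rw [SimpleGraph.dist_comm (u := φ i) (v := φ 0), SimpleGraph.dist_comm (u := φ 0) (v := φ j)] at h4
  unfold cycDist
  omega

open Classical in
/-- The distance from `u` computed along the decomposition of the graph at the block. -/
noncomputable def potential (G : SimpleGraph V) (E : Set (Sym2 V)) (n : ℕ) (φ : ℕ → V)
    (π : V → ℕ) (u w : V) : ℕ :=
  if π u = π w then (G.deleteEdges E).dist u w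
  else (G.deleteEdges E).dist u (φ (π u)) + cycDist n (π u) (π w) +
    (G.deleteEdges E).dist (φ (π w)) w

theorem potential_apply (C : GatedCycle G E n φ π) (u : V) {i : ℕ} (hi : i ≤ n) :
    potential G E n φ π u (φ i) =
      (G.deleteEdges E).dist u (φ (π u)) + cycDist n (π u) i := by
  have h1 := C.gate_apply_le hi
  have h2 := C.gate_lt u
  have h3 : φ (π (φ i)) = φ i := by
    rw [h1]; split_ifs with h
    · rw [h, C.closed]
    · rfl
  unfold potential
  rw [h3]
  split_ifs with h
  · rw [h, h3]
    have : cycDist n (π (φ i)) i = 0 := by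
      rw [h1]; unfold cycDist; split_ifs <;> omega
    omega
  · have : cycDist n (π u) (π (φ i)) = cycDist n (π u) i := by
      rw [h1]; unfold cycDist; split_ifs <;> omega
    rw [this, SimpleGraph.dist_self]; rfl

theorem potential_adj (C : GatedCycle G E n φ π) (u : V) {v w : V} (h : G.Adj v w) :
    potential G E n φ π u w ≤ potential G E n φ π u v + 1 := by
  by_cases he : s(v, w) ∈ E
  · obtain ⟨i, hi, he⟩ := (C.mem_iff _).1 he
    have h1 := C.potential_apply u (i := i) (by omega)
    have h2 := C.potential_apply u (i := i + 1) (by omega)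
    have h3 := C.gate_lt u
    have h4 : cycDist n (π u) i ≤ cycDist n (π u) (i + 1) + 1 ∧
        cycDist n (π u) (i + 1) ≤ cycDist n (π u) i + 1 := by
      unfold cycDist; omega
    rw [Sym2.eq_iff] at he
    rcases he with ⟨rfl, rfl⟩ | ⟨rfl, rfl⟩ <;> omega
  · have hadj : (G.deleteEdges E).Adj v w := by simp [h, he]
    have hπ : π v = π w := C.gate_eq_iff.2 hadj.reachable
    have h1 := SimpleGraph.dist_eq_one_iff_adj.2 hadj
    unfold potential
    rw [← hπ]
    split_ifs with h2
    · have := hadj.reachable.dist_triangle_right (u := u)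
      omega
    · have := hadj.reachable.dist_triangle_right (u := φ (π v))
      omega

theorem potential_le (C : GatedCycle G E n φ π) (hG : G.Connected) (u w : V) :
    potential G E n φ π u w ≤ G.dist u w := by
  obtain ⟨p, hp⟩ := hG.exists_walk_length_eq_dist w u
  rw [SimpleGraph.dist_comm, ← hp]
  clear hp
  induction p with
  | nil => simp [potential]
  | @cons _ _ t h p ih =>
    have := C.potential_adj t h.symm
    simp only [Walk.length_cons]
    omega

theorem dist_le_deleteEdges {u v : V} (h : (G.deleteEdges E).Reachable u v) :
    G.dist u v ≤ (G.deleteEdges E).dist u v :=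
  h.dist_anti (deleteEdges_le E)

theorem dist_eq (C : GatedCycle G E n φ π) (hG : G.Connected) {u v : V} (h : π u ≠ π v) :
    G.dist u v = G.dist (φ (π u)) u + cycDist n (π u) (π v) + G.dist (φ (π v)) v := by
  have h1 := C.potential_le hG u v
  rw [potential, if_neg h] at h1
  have h2 := dist_le_deleteEdges (C.gate_reachable u)
  have h3 := dist_le_deleteEdges (C.gate_reachable v)
  have h4 := C.dist_apply_le hG (C.gate_lt u) (C.gate_lt v)
  have h5 := hG.dist_triangle (u := u) (v := φ (π u)) (w := v)
  have h6 := hG.dist_triangle (u := φ (π u)) (v := φ (π v)) (w := v)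
  rw [SimpleGraph.dist_comm (G := G.deleteEdges E) (u := u)] at h1
  rw [SimpleGraph.dist_comm (u := u) (v := φ (π u))] at h5
  omega

theorem dist_apply (C : GatedCycle G E n φ π) (hG : G.Connected) {i : ℕ} (hi : i < n) (v : V) :
    G.dist (φ i) v = cycDist n i (π v) + G.dist (φ (π v)) v := by
  by_cases h : i = π v
  · subst h; simp [cycDist]
  · have := C.dist_eq hG (u := φ i) (v := v) (by rwa [C.gate_apply hi])
    rw [C.gate_apply hi, SimpleGraph.dist_self] at this
    omega

/-- A vertex at a prescribed distance from the gate, on a geodesic. -/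
theorem exists_height (C : GatedCycle G E n φ π) (hG : G.Connected) (v : V) {j : ℕ}
    (hj : j ≤ G.dist (φ (π v)) v) : ∃ w, π w = π v ∧ G.dist (φ (π v)) w = j := by
  obtain ⟨p, hp⟩ := hG.exists_walk_length_eq_dist (φ (π v)) v
  have h1 : G.dist (φ (π v)) (p.getVert j) ≤ j := by
    have := dist_le (p.take j)
    rw [Walk.take_length] at this
    omega
  have h2 : G.dist (p.getVert j) v ≤ G.dist (φ (π v)) v - j := by
    have := dist_le (p.drop j)
    rw [Walk.drop_length] at this
    omega
  have h3 := hG.dist_triangle (u := φ (π v)) (v := p.getVert j) (w := v)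
  refine ⟨p.getVert j, ?_, by omega⟩
  by_contra h
  have h4 := C.dist_eq hG h
  have h5 : 0 < cycDist n (π (p.getVert j)) (π v) := by
    have := C.gate_lt (p.getVert j)
    have := C.gate_lt v
    unfold cycDist; omega
  have h6 := C.dist_apply hG (C.gate_lt v) (p.getVert j)
  have h7 : j = 0 := by omega
  subst h7
  simp [C.gate_apply (C.gate_lt v)] at h

/-- Reversing the orientation of the cycle, keeping the base vertex `φ 0`. -/
theorem reflect (C : GatedCycle G E n φ π) :
    GatedCycle G E n (fun i => φ (n - i)) (fun v => if π v = 0 then 0 else n - π v) where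
  two_le := C.two_le
  block := C.block
  closed := by simp [C.closed]
  adj i hi := by
    have := (C.adj (n - (i + 1)) (by omega)).symm
    rwa [show n - (i + 1) + 1 = n - i by omega] at this
  mem_iff e := by
    rw [C.mem_iff]
    constructor
    · rintro ⟨i, hi, rfl⟩
      refine ⟨n - (i + 1), by omega, ?_⟩
      rw [Sym2.eq_swap, show n - (n - (i + 1)) = i + 1 by omega,
        show n - (n - (i + 1) + 1) = i by omega]
    · rintro ⟨i, hi, rfl⟩
      refine ⟨n - (i + 1), by omega, ?_⟩
      rw [Sym2.eq_swap, show n - (i + 1) + 1 = n - i by omega]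
  sep i hi j hj h := by
    have h1 := C.gate_eq_iff.2 h
    rw [C.gate_apply_le (by omega), C.gate_apply_le (by omega)] at h1
    split_ifs at h1 <;> omega
  gate_lt v := by
    have := C.gate_lt v
    split_ifs <;> omega
  gate_reachable v := by
    have h1 := C.gate_reachable v
    have h2 := C.gate_lt v
    split_ifs with h
    · rw [h] at h1
      simpa [C.closed] using h1
    · rwa [show n - (n - π v) = π v by omega]

end GatedCycle

theorem IsBlock.eq_of_mem [DecidableEq V] (hG : IsCactus G) {E₁ E₂ : Set (Sym2 V)}
    (h₁ : IsBlock G E₁) (h₂ : IsBlock G E₂) {e : Sym2 V} (he₁ : e ∈ E₁) (he₂ : e ∈ E₂) :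
    E₁ = E₂ := by
  rcases h₁ with ⟨u, c, hc, rfl⟩ | ⟨f, hf, hfb, rfl⟩ <;>
  rcases h₂ with ⟨u', c', hc', rfl⟩ | ⟨f', hf', hfb', rfl⟩
  · have := hG.2 _ _ c c' hc hc' e he₁ he₂
    ext x
    simpa using congrArg (fun s => x ∈ s) this
  · obtain rfl : e = f' := he₂
    exact absurd he₁ ((isBridge_iff_forall_cycle_notMem hf').1 hfb' c hc)
  · obtain rfl : e = f := he₁
    exact absurd he₂ ((isBridge_iff_forall_cycle_notMem hf).1 hfb c' hc')
  · obtain rfl : e = f := he₁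
    obtain rfl : e = f' := he₂
    rfl

/-- Two blocks sharing a vertex `z` either have the same gates or each of them lies in the part
of the other one that hangs at `z`. -/
theorem GatedCycle.gate_eq_or [DecidableEq V] (hG : IsCactus G) {E₁ E₂ : Set (Sym2 V)}
    {n₁ n₂ : ℕ} {φ₁ φ₂ : ℕ → V} {π₁ π₂ : V → ℕ} (C₁ : GatedCycle G E₁ n₁ φ₁ π₁)
    (C₂ : GatedCycle G E₂ n₂ φ₂ π₂) {m₁ m₂ : ℕ} (hm₁ : m₁ < n₁) (hm₂ : m₂ < n₂)
    (hz : φ₁ m₁ = φ₂ m₂) :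
    (∀ u v, π₁ u = π₁ v ↔ π₂ u = π₂ v) ∨ ∀ w, π₁ w ≠ m₁ → π₂ w = m₂ := by
  by_cases hE : E₁ = E₂
  · left
    intro u v
    rw [C₁.gate_eq_iff, C₂.gate_eq_iff, hE]
  right
  have hdisj : ∀ e ∈ E₁, e ∉ E₂ := fun e h₁ h₂ => hE (C₁.block.eq_of_mem hG C₂.block h₁ h₂)
  have key : ∀ {E E' : Set (Sym2 V)} {n : ℕ} {φ : ℕ → V} {π : V → ℕ},
      GatedCycle G E n φ π → (∀ e ∈ E, e ∉ E') → ∀ i ≤ n,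
        (G.deleteEdges E').Reachable (φ 0) (φ i) := by
    intro E E' n φ π C hd i hi
    induction i with
    | zero => exact Reachable.refl _
    | succ i ih =>
      refine (ih (by omega)).trans (Adj.reachable ?_)
      rw [deleteEdges_adj]
      exact ⟨C.adj i (by omega), hd _ ((C.mem_iff _).2 ⟨i, by omega, rfl⟩)⟩
  have key₁ : ∀ i ≤ n₁, ∀ j ≤ n₁, (G.deleteEdges E₂).Reachable (φ₁ i) (φ₁ j) := fun i hi j hj =>
    (key C₁ hdisj i hi).symm.trans (key C₁ hdisj j hj)
  have key₂ : ∀ i ≤ n₂, ∀ j ≤ n₂, (G.deleteEdges E₁).Reachable (φ₂ i) (φ₂ j) := fun i hi j hj =>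
    (key C₂ (fun e h₂ h₁ => hdisj e h₁ h₂) i hi).symm.trans
      (key C₂ (fun e h₂ h₁ => hdisj e h₁ h₂) j hj)
  intro w hw
  have hwalk : ∀ {a b : V}, (G.deleteEdges E₁).Walk a b → π₁ a ≠ m₁ →
      (G.deleteEdges E₂).Reachable a b := by
    intro a b p
    induction p with
    | nil => intro _; exact Reachable.refl _
    | @cons a c b h p ih =>
      intro ha
      have hac : π₁ a = π₁ c := C₁.gate_eq_iff.2 h.reachable
      refine Reachable.trans (Adj.reachable ?_) (ih (hac ▸ ha))
      rw [deleteEdges_adj] at h ⊢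
      refine ⟨h.1, fun he => ha ?_⟩
      obtain ⟨i, hi, he⟩ := (C₂.mem_iff _).1 he
      obtain ⟨j, hj, rfl⟩ : ∃ j ≤ n₂, a = φ₂ j := by
        rw [Sym2.eq_iff] at he
        rcases he with ⟨h, -⟩ | ⟨h, -⟩
        · exact ⟨i, by omega, h⟩
        · exact ⟨i + 1, by omega, h⟩
      rw [C₁.gate_eq_iff.2 (key₂ j hj m₂ hm₂.le), ← hz, C₁.gate_apply hm₁]
  obtain ⟨p⟩ := C₁.gate_reachable w
  have h1 := hwalk p (by rwa [C₁.gate_apply (C₁.gate_lt w)])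
  have h2 := (key₁ m₁ hm₁.le _ (C₁.gate_lt w).le).trans h1
  rw [hz] at h2
  rw [← C₂.gate_eq_iff.2 h2, C₂.gate_apply hm₂]

/-- A closed chain through a block whose vertices are separated by removing the edges of the
block admits a gate map. -/
theorem exists_gate (hG : G.Connected) {E : Set (Sym2 V)} {n : ℕ} {φ : ℕ → V} (two_le : 2 ≤ n)
    (block : IsBlock G E) (closed : φ n = φ 0) (adj : ∀ i < n, G.Adj (φ i) (φ (i + 1)))
    (mem_iff : ∀ e, e ∈ E ↔ ∃ i < n, e = s(φ i, φ (i + 1)))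
    (sep : ∀ i < n, ∀ j < n, (G.deleteEdges E).Reachable (φ i) (φ j) → i = j) :
    ∃ π, GatedCycle G E n φ π := by
  have hex : ∀ v, ∃ i < n, (G.deleteEdges E).Reachable (φ i) v := by
    intro v
    obtain ⟨p⟩ := hG v (φ 0)
    generalize hw : φ 0 = w at p
    induction p with
    | nil => exact ⟨0, by omega, by rw [hw]⟩
    | @cons a b c h p ih =>
      obtain ⟨i, hi, hr⟩ := ih hw
      by_cases he : s(a, b) ∈ E
      · obtain ⟨j, hj, he⟩ := (mem_iff _).1 he
        rw [Sym2.eq_iff] at he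
        rcases he with ⟨rfl, -⟩ | ⟨rfl, -⟩
        · exact ⟨j, hj, Reachable.refl _⟩
        · by_cases hjn : j + 1 = n
          · exact ⟨0, by omega, by rw [hjn, closed]⟩
          · exact ⟨j + 1, by omega, Reachable.refl _⟩
      · refine ⟨i, hi, hr.trans (Adj.reachable ?_)⟩
        rw [deleteEdges_adj, Sym2.eq_swap]
        exact ⟨h.symm, he⟩
  choose π hlt hr using hex
  exact ⟨π, two_le, block, closed, adj, mem_iff, sep, hlt, hr⟩

theorem exists_gate_of_bridge (hG : G.Connected) {x y : V} (h : G.Adj x y)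
    (hb : G.IsBridge s(x, y)) : ∃ E n φ π, GatedCycle G E n φ π ∧ φ 0 = x ∧ φ 1 = y := by
  have hsep := isBridge_iff.1 hb
  let φ : ℕ → V := fun i => if i = 1 then y else x
  obtain ⟨π, hπ⟩ := exists_gate hG (E := {s(x, y)}) (n := 2) (φ := φ) le_rfl
    (Or.inr ⟨_, h, hb, rfl⟩) (by simp [φ])
    (by intro i hi; interval_cases i <;> simp [φ, h, h.symm])
    (by
      intro e
      constructor
      · rintro rfl
        exact ⟨0, by omega, by simp [φ]⟩
      · rintro ⟨i, hi, rfl⟩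
        interval_cases i <;> simp [φ])
    (by
      intro i hi j hj hr
      interval_cases i <;> interval_cases j <;> simp [φ] at hr ⊢
      · exact hsep hr
      · exact hsep hr.symm)
  exact ⟨_, 2, φ, π, hπ, by simp [φ], by simp [φ]⟩

theorem getVert_sep_of_lt [DecidableEq V] (hG : IsCactus G) {x : V} {c : G.Walk x x}
    (hc : c.IsCycle) {i j : ℕ} (hij : i < j) (hj : j < c.length)
    (hr : (G.deleteEdges {e | e ∈ c.edges}).Reachable (c.getVert i) (c.getVert j)) : False := by
  have hmem : ∀ k < c.length, s(c.getVert k, c.getVert (k + 1)) ∈ c.edges := fun k hk =>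
    (Walk.mk_mem_edges_iff_exists c).2 ⟨k, hk, rfl⟩
  have hne : ∀ k < c.length, ∀ l < c.length, k ≠ l →
      s(c.getVert k, c.getVert (k + 1)) ≠ s(c.getVert l, c.getVert (l + 1)) := by
    intro k hk l hl hkl h
    rw [← Walk.getElem_edges (by simpa using hk), ← Walk.getElem_edges (by simpa using hl)] at h
    exact hkl ((hc.edges_nodup.getElem_inj_iff).1 h)
  set f := s(c.getVert j, c.getVert (j + 1)) with hf
  set e := s(c.getVert i, c.getVert (i + 1)) with he
  have hef := hne i (by omega) j hj (by omega)
  have hadj : (G.deleteEdges {f}).Adj (c.getVert i) (c.getVert (i + 1)) := by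
    rw [deleteEdges_adj]
    exact ⟨c.adj_getVert_succ (by omega), fun h => hef h⟩
  have harc : ∀ k, i + 1 ≤ k → k ≤ j →
      ((G.deleteEdges {f}) \ fromEdgeSet {e}).Reachable (c.getVert (i + 1)) (c.getVert k) := by
    intro k hk
    induction k, hk using Nat.le_induction with
    | base => intro _; exact Reachable.refl _
    | succ k hk ih =>
      intro hkj
      refine (ih (by omega)).trans (Adj.reachable ?_)
      have h1 := hne k (by omega) i (by omega) (by omega)
      have h2 := hne k (by omega) j (by omega) (by omega)
      have h3 := c.adj_getVert_succ (i := k) (by omega)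
      simp only [sdiff_adj, deleteEdges_adj, fromEdgeSet_adj, Set.mem_singleton_iff]
      exact ⟨⟨h3, h2⟩, fun h => h1 h.1⟩
  have hback : ((G.deleteEdges {f}) \ fromEdgeSet {e}).Reachable (c.getVert i) (c.getVert j) := by
    refine hr.mono fun a b h => ?_
    simp only [deleteEdges_adj, Set.mem_ofPred_eq] at h
    simp only [sdiff_adj, deleteEdges_adj, fromEdgeSet_adj, Set.mem_singleton_iff]
    refine ⟨⟨h.1, fun h' => h.2 (h' ▸ hmem j hj)⟩, fun h' => h.2 (h'.1 ▸ hmem i (by omega))⟩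
  obtain ⟨u, p, hp, hep⟩ := adj_and_reachable_delete_edges_iff_exists_cycle.1
    ⟨hadj, hback.trans (harc j (by omega) le_rfl).symm⟩
  have hle : G.deleteEdges {f} ≤ G := deleteEdges_le _
  have heq := hG.2 _ _ c (p.mapLe hle) hc (hp.mapLe hle) e (hmem i (by omega)) (by simpa using hep)
  have hfp : f ∈ (p.mapLe hle).edges := by
    have : f ∈ c.edges.toFinset := by simpa using hmem j hj
    rw [heq] at this
    simpa using this
  rw [Walk.edges_mapLe_eq_edges] at hfp
  have := p.edges_subset_edgeSet hfp
  simp at this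

theorem exists_gate_of_adj [DecidableEq V] (hG : IsCactus G) {x y : V} (h : G.Adj x y) :
    ∃ E n φ π, GatedCycle G E n φ π ∧ φ 0 = x ∧ φ 1 = y := by
  by_cases hb : G.IsBridge s(x, y)
  · exact exists_gate_of_bridge hG.1 h hb
  rw [isBridge_iff, not_not] at hb
  obtain ⟨p, hp⟩ := hb.symm.exists_isPath
  have hle : G.deleteEdges {s(x, y)} ≤ G := deleteEdges_le _
  have hnot : s(x, y) ∉ (p.mapLe hle).edges := by
    intro hmem
    rw [Walk.edges_mapLe_eq_edges] at hmem
    have := p.edges_subset_edgeSet hmem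
    simp at this
  have hc : (Walk.cons h (p.mapLe hle)).IsCycle :=
    (Walk.cons_isCycle_iff _ h).2 ⟨hp.mapLe hle, hnot⟩
  set c := Walk.cons h (p.mapLe hle) with hcdef
  obtain ⟨π, hπ⟩ := exists_gate hG.1 (E := {e | e ∈ c.edges}) (n := c.length) (φ := c.getVert)
    (by have := hc.three_le_length; omega) (Or.inl ⟨x, c, hc, rfl⟩) (by simp)
    (fun i hi => c.adj_getVert_succ hi)
    (by
      intro e
      induction e with | _ a b
      rw [Set.mem_ofPred_eq, Walk.mk_mem_edges_iff_exists]
      simp only [eq_comm])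
    (by
      intro i hi j hj hr
      rcases lt_trichotomy i j with hij | hij | hij
      · exact (getVert_sep_of_lt hG hc hij hj hr).elim
      · exact hij
      · exact (getVert_sep_of_lt hG hc hij hi hr.symm).elim)
  exact ⟨_, _, _, π, hπ, by simp, by simp [hcdef]⟩

/-- Any vertex `u ≠ x` is separated from `x` by a block through `x`. -/
theorem exists_gate_of_ne [DecidableEq V] (hG : IsCactus G) {x u : V} (h : u ≠ x) :
    ∃ E n φ π, GatedCycle G E n φ π ∧ φ 0 = x ∧ π u ≠ 0 := by
  obtain ⟨p, hp⟩ := hG.1.exists_walk_length_eq_dist x u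
  cases p with
  | nil => exact absurd rfl h
  | @cons _ y _ hadj q =>
    obtain ⟨E, n, φ, π, C, rfl, rfl⟩ := exists_gate_of_adj hG hadj
    refine ⟨E, n, φ, π, C, rfl, fun h0 => ?_⟩
    have h1 := C.dist_apply hG.1 (i := 1) (by have := C.two_le; omega) u
    have h2 := C.dist_apply hG.1 (i := 0) (by have := C.two_le; omega) u
    have h3 := dist_le q
    have h4 := C.two_le
    rw [Walk.length_cons] at hp
    rw [h0] at h1 h2
    unfold cycDist at h1 h2
    omega


theorem cycDist_spec {n i j : ℕ} (hi : i < n) (hj : j < n) :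
    (i ≤ j ∧ 2 * (j - i) ≤ n ∧ cycDist n i j = j - i) ∨
    (i ≤ j ∧ n < 2 * (j - i) ∧ cycDist n i j + j = n + i) ∨
    (j < i ∧ 2 * (i - j) ≤ n ∧ cycDist n i j = i - j) ∨
    (j < i ∧ n < 2 * (i - j) ∧ cycDist n i j + i = n + j) := by
  unfold cycDist; omega

theorem cycDist_zero_of_two_mul_le {n i : ℕ} (hi : 2 * i ≤ n) : cycDist n 0 i = i := by
  unfold cycDist; omega

theorem cycDist_zero_of_le_two_mul {n i : ℕ} (hi : n ≤ 2 * i) : cycDist n 0 i = n - i := by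
  unfold cycDist; omega

theorem cycDist_comm (n i j : ℕ) : cycDist n i j = cycDist n j i := by
  unfold cycDist; omega

theorem center_position_first {n a c r r' i k hu hw du dw x₁ x₂ : ℕ}
    (hac : a ≤ c) (hc : 2 * c ≤ n) (hi : i < n) (hn : 0 < n)
    (hur : a + hu = r) (hwr : c + hw = r + 1) (hu' : du ≤ r') (hw' : r' < dw)
    (e₁ : i ≠ a ∧ du = k + x₁ + hu ∨ i = a ∧ du ≤ k + hu ∧ k ≤ du + hu ∧ hu ≤ du + k)
    (e₂ : i ≠ c ∧ dw = k + x₂ + hw ∨ i = c ∧ dw ≤ k + hw ∧ k ≤ dw + hw ∧ hw ≤ dw + k)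
    (h₁ : x₁ = cycDist n i a) (h₂ : x₂ = cycDist n i c) :
    i = a ∧ r' < k + x₂ + hw ∨
    (i ≠ a ∧ k + x₁ + hu = r' ∧
      (i < a ∧ x₁ = a - i ∨ a < i ∧ c = a ∨
        a < i ∧ a < c ∧ x₁ + i = n + a ∧ n + 2 * c ≤ 2 * i)) := by
  have s₁ := cycDist_spec (i := i) (j := a) (n := n) (by omega) (by omega)
  have s₂ := cycDist_spec (i := i) (j := c) (n := n) (by omega) (by omega)
  rw [← h₁] at s₁
  rw [← h₂] at s₂
  rcases e₁ with ⟨h, e₁⟩ | e₁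
  · right
    have h₃ : r' < k + x₂ + hw := by rcases e₂ with e₂ | e₂ <;> omega
    have h₄ : x₂ ≤ x₁ + (c - a) := by clear e₂ h₃ e₁ hu' hw'; omega
    have h₅ : x₂ + a = x₁ + c := by omega
    refine ⟨h, by omega, ?_⟩
    clear e₂ h₃ e₁ hu' hw' h₄
    rcases s₁ with s₁ | s₁ | s₁ | s₁ <;> rcases s₂ with s₂ | s₂ | s₂ | s₂ <;> omega
  · exact Or.inl ⟨e₁.1, by rcases e₂ with e₂ | e₂ <;> omega⟩

theorem center_position {n a b c r r' i k hu hv hw du dv dw : ℕ}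
    (ha : 0 < a) (hac : a ≤ c) (hc : 2 * c ≤ n) (hi : i < n) (hbn : b < n)
    (hur : a + hu = r) (hwr : c + hw = r + 1)
    (hb : b = 0 ∧ hv ≤ r ∧ r ≤ hv + 1 ∨
      n < 2 * b ∧ n + hv ≤ r + b ∧ r + b ≤ n + hv + 1 ∧ r < hv + b)
    (hr' : r' ≤ r) (hu' : du ≤ r') (hv' : dv ≤ r') (hw' : r' < dw)
    (e₁ : i ≠ a ∧ du = k + cycDist n i a + hu ∨
      i = a ∧ du ≤ k + hu ∧ k ≤ du + hu ∧ hu ≤ du + k)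
    (e₂ : i ≠ b ∧ dv = k + cycDist n i b + hv ∨
      i = b ∧ dv ≤ k + hv ∧ k ≤ dv + hv ∧ hv ≤ dv + k)
    (e₃ : i ≠ c ∧ dw = k + cycDist n i c + hw ∨
      i = c ∧ dw ≤ k + hw ∧ k ≤ dw + hw ∧ hw ≤ dw + k) :
    (i = 0 ∧ k = 0 ∧ r' = r) ∨ (c = a ∧ a < i ∧ i ≤ 2 * a ∧ k + r + i = r' + 2 * a) := by
  have h := center_position_first hac hc hi (by omega) hur hwr hu' hw' e₁ e₃ rfl rfl
  clear e₁ e₃ hu' hw'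
  have s₂ := cycDist_spec (i := i) (j := b) (n := n) (by omega) (by omega)
  generalize cycDist n i b = x₂ at *
  rcases h with ⟨rfl, h⟩ | ⟨hia, h₈, h | ⟨h, rfl⟩ | h⟩
  · have h₃ : cycDist n i c = c - i := by unfold cycDist; omega
    exfalso
    rcases hb with hb | hb <;> omega
  · left
    rcases hb with hb | hb <;> rcases e₂ with e₂ | e₂ <;> omega
  · have s₁ := cycDist_spec (i := i) (j := c) (n := n) (by omega) (by omega)
    by_cases h₉ : 2 * (i - c) ≤ n
    · right
      omega
    · left
      have : cycDist n i c + i = n + c := by omega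
      clear s₁ h₉
      rcases e₂ with e₂ | e₂ <;> rcases hb with hb | hb <;> omega
  · left
    rcases hb with hb | hb <;> rcases e₂ with e₂ | e₂ <;> omega

namespace GatedCycle

variable {E : Set (Sym2 V)} {n : ℕ} {φ : ℕ → V} {π : V → ℕ}

theorem dist_cases (C : GatedCycle G E n φ π) (hG : G.Connected) (u v : V) :
    (π u ≠ π v ∧
      G.dist u v = G.dist (φ (π u)) u + cycDist n (π u) (π v) + G.dist (φ (π v)) v) ∨
    (π u = π v ∧ G.dist u v ≤ G.dist (φ (π u)) u + G.dist (φ (π v)) v ∧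
      G.dist (φ (π u)) u ≤ G.dist u v + G.dist (φ (π v)) v ∧
      G.dist (φ (π v)) v ≤ G.dist u v + G.dist (φ (π u)) u) := by
  by_cases h : π u = π v
  · right
    rw [h]
    have h1 := hG.dist_triangle (u := u) (v := φ (π v)) (w := v)
    have h2 := hG.dist_triangle (u := φ (π v)) (v := v) (w := u)
    have h3 := hG.dist_triangle (u := φ (π v)) (v := u) (w := v)
    have h4 := SimpleGraph.dist_comm (G := G) (u := u) (v := φ (π v))
    have h5 := SimpleGraph.dist_comm (G := G) (u := u) (v := v)
    omega
  · exact Or.inl ⟨h, C.dist_eq hG h⟩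

theorem exists_dist_eq (C : GatedCycle G E n φ π) (hG : G.Connected) {w : V} {s : ℕ}
    (h₁ : cycDist n 0 (π w) ≤ s) (h₂ : s ≤ G.dist (φ 0) w) :
    ∃ w', π w' = π w ∧ G.dist (φ 0) w' = s := by
  have hn := C.two_le
  rw [C.dist_apply hG (by omega)] at h₂
  obtain ⟨w', h₃, h₄⟩ := C.exists_height hG w (j := s - cycDist n 0 (π w)) (by omega)
  refine ⟨w', h₃, ?_⟩
  rw [C.dist_apply hG (by omega), h₃, h₄]
  omega

theorem center_cases (C : GatedCycle G E n φ π) (hG : G.Connected) {r r' : ℕ} {x' u v w : V}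
    (ha : 0 < π u) (hac : π u ≤ π w) (hc : 2 * π w ≤ n)
    (hu : G.dist (φ 0) u = r) (hw : G.dist (φ 0) w = r + 1)
    (hv₁ : G.dist (φ 0) v ≤ r) (hv₂ : r ≤ G.dist (φ 0) v + 1)
    (hv₃ : π v = 0 ∨ n + r < 2 * π v + G.dist (φ 0) v) (hr' : r' ≤ r)
    (hu' : G.dist x' u ≤ r') (hv' : G.dist x' v ≤ r') (hw' : r' < G.dist x' w) :
    (x' = φ 0 ∧ r' = r) ∨ (π w = π u ∧ π u < π x' ∧ π x' ≤ 2 * π u ∧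
      G.dist (φ (π x')) x' + r + π x' = r' + 2 * π u) := by
  have h₀ := C.two_le
  have hb := C.gate_lt v
  rw [C.dist_apply hG (by omega)] at hu hw hv₁ hv₂ hv₃
  rw [cycDist_zero_of_two_mul_le (by omega)] at hu hw
  have hv : π v = 0 ∧ G.dist (φ (π v)) v ≤ r ∧ r ≤ G.dist (φ (π v)) v + 1 ∨
      n < 2 * π v ∧ n + G.dist (φ (π v)) v ≤ r + π v ∧ r + π v ≤ n + G.dist (φ (π v)) v + 1 ∧
        r < G.dist (φ (π v)) v + π v := by
    rcases hv₃ with h | h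
    · rw [h, cycDist_zero_of_two_mul_le (by omega)] at hv₁ hv₂
      rw [h]
      omega
    · have h' : n ≤ 2 * π v := by omega
      rw [cycDist_zero_of_le_two_mul h'] at hv₁ hv₂ h
      omega
  rcases center_position ha hac hc (C.gate_lt x') hb hu hw hv hr' hu' hv' hw'
    (C.dist_cases hG x' u) (C.dist_cases hG x' v) (C.dist_cases hG x' w) with ⟨h₁, h₂, h₃⟩ | h
  · left
    rw [hG.dist_eq_zero_iff, h₁] at h₂
    exact ⟨h₂.symm, h₃⟩
  · exact Or.inr h

end GatedCycle

/-- The ball of radius `r` around `x` is told apart by at most four vertices, at least one of them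
outside of it, from all other balls of at most the same radius. -/
def Separable (G : SimpleGraph V) (x : V) (r : ℕ) : Prop :=
  ∃ S : Finset V, S.card ≤ 4 ∧ (∃ q ∈ S, q ∉ gball G x r) ∧
    ∀ x' r', r' ≤ r → (∀ q ∈ S, q ∈ gball G x r ↔ q ∈ gball G x' r') →
      gball G x' r' = gball G x r

theorem mem_gball {x v : V} {r : ℕ} : v ∈ gball G x r ↔ G.dist x v ≤ r := Iff.rfl

namespace GatedCycle

variable {E : Set (Sym2 V)} {n : ℕ} {φ : ℕ → V} {π : V → ℕ} [DecidableEq V]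

/-- The ball is separable if a vertex outside of it is attached beyond `u`. -/
theorem separable_of_beyond (C : GatedCycle G E n φ π) (hG : G.Connected) {r : ℕ} {x u v w : V}
    (hx : φ 0 = x) (ha : 0 < π u) (hac : π u < π w) (hc : 2 * π w ≤ n)
    (hu : G.dist x u = r) (hw : r < G.dist x w)
    (hv₁ : G.dist x v ≤ r) (hv₂ : r ≤ G.dist x v + 1)
    (hv₃ : π v = 0 ∨ n + r < 2 * π v + G.dist x v) : Separable G x r := by
  subst hx
  have hn := C.two_le
  obtain ⟨w', h₁, h₂, h₃⟩ : ∃ w', π u < π w' ∧ 2 * π w' ≤ n ∧ G.dist (φ 0) w' = r + 1 := by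
    by_cases h : π w ≤ r + 1
    · obtain ⟨w', h₁, h₂⟩ := C.exists_dist_eq hG (w := w) (s := r + 1)
        (by rwa [cycDist_zero_of_two_mul_le hc]) (by omega)
      exact ⟨w', by omega, by omega, h₂⟩
    · rw [C.dist_apply hG (by omega), cycDist_zero_of_two_mul_le (by omega)] at hu
      refine ⟨φ (r + 1), ?_⟩
      rw [C.dist_apply hG (by omega), C.gate_apply (by omega), SimpleGraph.dist_self,
        cycDist_zero_of_two_mul_le (by omega)]
      omega
  refine ⟨{u, v, w'}, Finset.card_le_three.trans (by omega), ⟨w', by simp, ?_⟩, ?_⟩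
  · rw [mem_gball]; omega
  · intro x' r' hr' h
    simp only [Finset.mem_insert, Finset.mem_singleton, forall_eq_or_imp, forall_eq,
      mem_gball] at h
    rcases C.center_cases hG (x' := x') (v := v) ha h₁.le h₂ hu h₃ hv₁ hv₂ hv₃ hr' (h.1.1 hu.le)
      (h.2.1.1 hv₁) (by omega) with ⟨rfl, rfl⟩ | h₄
    · rfl
    · omega

/-- The ball is separable if the vertices outside of it are attached at the gate of `u`, or far
away from it on the other side. -/
theorem separable_of_forall (C : GatedCycle G E n φ π) (hG : G.Connected) {r : ℕ} {x u v w : V}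
    (hmin : ∀ x' r', gball G x' r' = gball G x r → r ≤ r')
    (hx : φ 0 = x) (ha : 0 < π u) (hc : 2 * π u ≤ n)
    (hu : G.dist x u = r) (hwu : π w = π u) (hw : r < G.dist x w)
    (hv₁ : G.dist x v ≤ r) (hv₂ : r ≤ G.dist x v + 1)
    (hv₃ : π v = 0 ∨ n + r < 2 * π v + G.dist x v)
    (hout : ∀ w, r < G.dist x w → π w = π u ∨ 2 * π u + n ≤ 2 * π w) : Separable G x r := by
  subst hx
  have hn := C.two_le
  have har : π u ≤ r := by
    rw [C.dist_apply hG (by omega), cycDist_zero_of_two_mul_le (by omega)] at hu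
    omega
  obtain ⟨w₁, h₁, h₂⟩ := C.exists_dist_eq hG (w := w) (s := r + 1)
    (by rw [cycDist_zero_of_two_mul_le (by omega)]; omega) (by omega)
  set a := π u with ha'
  have hsub : gball G (φ (2 * a)) r ⊆ gball G (φ 0) r := by
    intro y hy
    rw [mem_gball] at hy ⊢
    by_contra! hy'
    rcases hc.lt_or_eq with hc' | hc'
    · rw [C.dist_apply hG hc'] at hy
      rw [C.dist_apply hG (by omega)] at hy'
      have : cycDist n 0 (π y) ≤ cycDist n (2 * a) (π y) := by
        have h₃ := C.gate_lt y
        rcases hout y (by rwa [C.dist_apply hG (by omega)]) with h | h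
        · rw [h]; unfold cycDist; omega
        · unfold cycDist; omega
      omega
    · rw [hc', C.closed] at hy
      omega
  obtain ⟨w₂, h₃, τ, h₄, h₅, h₆, h₇⟩ : ∃ w₂, G.dist (φ 0) w₂ ≤ r ∧ ∃ τ, a ≤ τ ∧ τ ≤ 2 * a ∧
      r + τ < 2 * a + G.dist (φ τ) w₂ ∧
      (τ = 2 * a ∨ τ + 1 = 2 * a ∧ gball G (φ (2 * a)) r = gball G (φ 0) r) := by
    by_cases heq : gball G (φ (2 * a)) r = gball G (φ 0) r
    · have hsub' : gball G (φ (2 * a - 1)) (r - 1) ⊆ gball G (φ 0) r := by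
        intro y hy
        rw [← heq]
        rw [mem_gball] at hy ⊢
        have h₅ := SimpleGraph.dist_eq_one_iff_adj.2 (C.adj (2 * a - 1) (by omega)).symm
        have h₆ := hG.dist_triangle (u := φ (2 * a - 1 + 1)) (v := φ (2 * a - 1)) (w := y)
        rw [show 2 * a - 1 + 1 = 2 * a by omega] at h₅ h₆
        omega
      have hne : ¬ gball G (φ 0) r ⊆ gball G (φ (2 * a - 1)) (r - 1) := fun h => by
        have := hmin _ _ (hsub'.antisymm h)
        omega
      obtain ⟨w₂, h₃, h₄⟩ := Set.not_subset.1 hne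
      rw [mem_gball] at h₃ h₄
      exact ⟨w₂, h₃, 2 * a - 1, by omega, by omega, by omega, Or.inr ⟨by omega, heq⟩⟩
    · obtain ⟨w₂, h₃, h₄⟩ := Set.not_subset.1 fun h => heq (hsub.antisymm h)
      rw [mem_gball] at h₃ h₄
      exact ⟨w₂, h₃, 2 * a, by omega, by omega, by omega, Or.inl rfl⟩
  refine ⟨{u, v, w₁, w₂}, Finset.card_le_four, ⟨w₁, by simp, ?_⟩, ?_⟩
  · rw [mem_gball]; omega
  · intro x' r' hr' h
    simp only [Finset.mem_insert, Finset.mem_singleton, forall_eq_or_imp, forall_eq,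
      mem_gball] at h
    obtain ⟨hu', hv', hw₁, hw₂⟩ := h
    rcases C.center_cases hG (x' := x') (u := u) (w := w₁) (v := v) ha (by omega) (by omega) hu h₂
      hv₁ hv₂ hv₃ hr' (hu'.1 hu.le) (hv'.1 hv₁) (by omega) with ⟨rfl, rfl⟩ | ⟨-, h₈, h₉, h₁₀⟩
    · rfl
    rw [← ha'] at *
    have hi := C.gate_lt x'
    have h₁₁ : G.dist (φ (π x')) w₂ + 2 * a ≤ r + π x' := by
      rw [C.dist_apply hG (by omega)] at h₃ ⊢
      have h₁₁ := hw₂.1 (by rwa [C.dist_apply hG (by omega)])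
      rcases C.dist_cases hG x' w₂ with ⟨-, h⟩ | ⟨h, -⟩
      · omega
      · rw [← h] at h₃ ⊢
        have : 2 * a ≤ π x' + cycDist n 0 (π x') := by unfold cycDist; omega
        have : cycDist n (π x') (π x') = 0 := by simp [cycDist]
        omega
    by_cases h₁₂ : π x' ≤ τ
    · have h₁₃ := C.dist_apply_le_sub hG h₁₂ (by omega)
      have h₁₄ := hG.dist_triangle (u := φ τ) (v := φ (π x')) (w := w₂)
      rw [SimpleGraph.dist_comm (u := φ τ) (v := φ (π x'))] at h₁₄
      omega
    · have h₁₅ : G.dist (φ (π x')) x' = 0 := by omega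
      rw [hG.dist_eq_zero_iff] at h₁₅
      have h₁₆ : π x' = 2 * a := by omega
      rw [← h₁₅, h₁₆, show r' = r by omega]
      rcases h₇ with h₇ | h₇
      · omega
      · exact h₇.2

end GatedCycle

/-- The ball `gball G z q` agrees with `B` on two parts hanging at positions `a` and `b` of a cycle
which contain the complement of `B`, where `z` lies strictly between `a` and `b`. -/
structure Opposed (G : SimpleGraph V) (B : Set V) (z : V) (q : ℕ) (E : Set (Sym2 V)) (n : ℕ)
    (φ : ℕ → V) (π : V → ℕ) (m a b : ℕ) : Prop where
  gated : GatedCycle G E n φ π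
  lt_m : m < n
  lt_a : a < n
  lt_b : b < n
  apply_m : φ m = z
  ne_a : a ≠ m
  ne_b : b ≠ m
  between : cycDist n a m + cycDist n m b = cycDist n a b
  short : 2 * cycDist n a b < n
  dist_le_of_gate : ∀ w, π w = m → G.dist z w ≤ q
  gate_of_notMem : ∀ w, w ∉ B → π w = a ∨ π w = b
  exists_far : ∃ w, q < G.dist z w ∧ π w ≠ a ∧ π w ≠ b
  exists_a : ∃ u, π u = a ∧ G.dist z u = q
  exists_b : ∃ u, π u = b ∧ G.dist z u = q
  exists_a' : ∃ u, π u = a ∧ G.dist z u = q + 1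
  exists_b' : ∃ u, π u = b ∧ G.dist z u = q + 1

/-- The ball `gball G z q` may be hard to distinguish from `B`. -/
def Partner (G : SimpleGraph V) (B : Set V) (z : V) (q : ℕ) : Prop :=
  ∃ E n φ π m a b, Opposed G B z q E n φ π m a b

/-- Four vertices distinguish the ball from all balls except from one partner. -/
def AlmostSeparable (G : SimpleGraph V) (x : V) (r : ℕ) : Prop :=
  ∃ z q, Partner G (gball G x r) z q ∧ ∃ S : Finset V, S.card ≤ 4 ∧ (∃ p ∈ S, p ∉ gball G x r) ∧
    ∀ x' r', (∀ p ∈ S, p ∈ gball G x r ↔ p ∈ gball G x' r') →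
      gball G x' r' = gball G x r ∨ gball G x' r' = gball G z q

theorem cycDist_add_of_le {n i j : ℕ} (h : i ≤ j) (h' : 2 * j ≤ n + 2 * i) :
    cycDist n i j + i = j := by
  unfold cycDist; omega

theorem opposite_center_position {n a b r r' i k hu hv du du' dv dv' : ℕ}
    (ha : 0 < a) (ha' : 2 * a < n) (hb : n < 2 * b) (hab : 2 * b < 2 * a + n) (hbn : b < n)
    (hi : i < n) (hur : a + hu = r) (hvr : n + hv = r + b)
    (hu₁ : du ≤ r') (hu₂ : r' < du') (hv₁ : dv ≤ r') (hv₂ : r' < dv')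
    (e₁ : i ≠ a ∧ du = k + cycDist n i a + hu ∨
      i = a ∧ du ≤ k + hu ∧ k ≤ du + hu ∧ hu ≤ du + k)
    (e₂ : i ≠ a ∧ du' = k + cycDist n i a + (hu + 1) ∨
      i = a ∧ du' ≤ k + (hu + 1) ∧ k ≤ du' + (hu + 1) ∧ hu + 1 ≤ du' + k)
    (e₃ : i ≠ b ∧ dv = k + cycDist n i b + hv ∨
      i = b ∧ dv ≤ k + hv ∧ k ≤ dv + hv ∧ hv ≤ dv + k)
    (e₄ : i ≠ b ∧ dv' = k + cycDist n i b + (hv + 1) ∨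
      i = b ∧ dv' ≤ k + (hv + 1) ∧ k ≤ dv' + (hv + 1) ∧ hv + 1 ≤ dv' + k) :
    (i = 0 ∧ r' = k + r) ∨ (2 * i + n = 2 * a + 2 * b ∧ r' + 2 * a = k + r + i) := by
  have s₁ := cycDist_spec (i := i) (j := a) (n := n) hi (by omega)
  have s₂ := cycDist_spec (i := i) (j := b) (n := n) hi hbn
  generalize cycDist n i a = x₁ at *
  generalize cycDist n i b = x₂ at *
  rcases e₁ with e₁ | e₁
  · have h₁ : r' = k + x₁ + hu := by omega
    clear e₂
    rcases e₃ with e₃ | e₃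
    · have h₁ : r' = k + x₂ + hv := by omega
      clear e₃ e₄
      rcases s₁ with s₁ | s₁ | s₁ | s₁ <;> rcases s₂ with s₂ | s₂ | s₂ | s₂ <;> omega
    · omega
  · clear s₁
    omega

namespace GatedCycle

variable {E : Set (Sym2 V)} {n : ℕ} {φ : ℕ → V} {π : V → ℕ}

theorem gball_eq_of_gate (C : GatedCycle G E n φ π) (hG : G.Connected) {x' : V} {q : ℕ}
    (h : ∀ w, π w = π x' → G.dist (φ (π x')) w ≤ q) :
    gball G x' (G.dist (φ (π x')) x' + q) = gball G (φ (π x')) q := by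
  ext w
  rw [mem_gball, mem_gball]
  have h₁ := h w
  rw [C.dist_apply hG (C.gate_lt x') w] at h₁ ⊢
  rcases C.dist_cases hG x' w with h₂ | ⟨h₂, h₃⟩
  · omega
  · rw [← h₂] at h₁ h₃ ⊢
    simp [cycDist] at h₁ ⊢
    omega

theorem dist_gate_add_le (C : GatedCycle G E n φ π) (hG : G.Connected) {a r : ℕ} {w : V}
    (ha : a ≤ π w) (ha' : 2 * a ≤ n) (h : G.dist (φ 0) w ≤ r) :
    G.dist (φ (π w)) w + 2 * a ≤ r + π w := by
  have h₁ := C.gate_lt w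
  rw [C.dist_apply hG (by omega)] at h
  have : 2 * a ≤ π w + cycDist n 0 (π w) := by unfold cycDist; omega
  omega

theorem opposed_of_opposite (C : GatedCycle G E n φ π) (hG : G.Connected) {r m q : ℕ}
    {u u' v v' : V} (ha' : 2 * π u < n) (hb : n < 2 * π v)
    (hab : 2 * π v < 2 * π u + n) (hu : G.dist (φ 0) u = r) (hv : G.dist (φ 0) v = r)
    (hu' : G.dist (φ 0) u' = r + 1) (hv' : G.dist (φ 0) v' = r + 1)
    (huu' : π u' = π u) (hvv' : π v' = π v)
    (hout : ∀ w, r < G.dist (φ 0) w → π w = π u ∨ π w = π v)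
    (hm : 2 * m + n = 2 * π u + 2 * π v)
    (hq : q + 2 * π u = r + m)
    (hne : gball G (φ m) q ≠ gball G (φ 0) r) :
    Opposed G (gball G (φ 0) r) (φ m) q E n φ π m (π u) (π v) := by
  have hbn := C.gate_lt v
  have ca := cycDist_zero_of_two_mul_le ha'.le
  have cb := cycDist_zero_of_le_two_mul hb.le
  have dn : ∀ w, G.dist (φ 0) w = _ := C.dist_apply hG (by omega)
  have hum : π u < m := by omega
  have hmv : m < π v := by omega
  have hmn : m < n := by omega
  have d₁ := cycDist_add_of_le (n := n) hum.le (by omega)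
  have d₂ := cycDist_add_of_le (n := n) hmv.le (by omega)
  have d₃ := cycDist_add_of_le (n := n) (hum.trans hmv).le (by omega)
  have d₁' := cycDist_comm n (π u) m
  have dm : ∀ w, G.dist (φ m) w = _ := C.dist_apply hG hmn
  have h₁ := dn u
  have h₂ := dn v
  have h₃ := dn u'
  have h₄ := dn v'
  rw [huu'] at h₃
  rw [hvv'] at h₄
  rw [ca] at h₁ h₃
  rw [cb] at h₂ h₄
  refine ⟨C, hmn, by omega, hbn, rfl, hum.ne, hmv.ne', by omega, by omega, ?_, ?_, ?_,
    ⟨u, rfl, ?_⟩, ⟨v, rfl, ?_⟩, ⟨u', huu', ?_⟩, ⟨v', hvv', ?_⟩⟩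
  · intro w hw
    have h₇ : G.dist (φ 0) w ≤ r := by
      by_contra! h
      rcases hout w h with h | h <;> omega
    have := C.dist_gate_add_le hG (a := π u) (by omega) (by omega) h₇
    rw [hw] at this
    omega
  · intro w hw
    exact hout w (by simpa [mem_gball] using hw)
  · by_contra! hc
    apply hne
    ext w
    rw [mem_gball, mem_gball]
    by_cases h₅ : π w = π u
    · rw [dn, dm, h₅, ca, ← d₁']
      constructor <;> intro <;> omega
    by_cases h₆ : π w = π v
    · rw [dn, dm, h₆, cb]
      constructor <;> intro <;> omega
    have h₇ : G.dist (φ 0) w ≤ r := by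
      by_contra! h
      rcases hout w h with h | h <;> omega
    have h₈ : G.dist (φ m) w ≤ q := by
      by_contra! h
      exact h₆ (hc w h h₅)
    exact iff_of_true h₈ h₇
  · rw [dm]; omega
  · rw [dm]; omega
  · rw [dm, huu']; omega
  · rw [dm, hvv']; omega

variable [DecidableEq V]

theorem separable_or_of_opposite (C : GatedCycle G E n φ π) (hG : G.Connected) {r : ℕ}
    {x u v w w' : V} (hmin : ∀ x' r', gball G x' r' = gball G x r → r ≤ r')
    (hx : φ 0 = x) (ha : 0 < π u) (ha' : 2 * π u < n) (hb : n < 2 * π v)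
    (hab : 2 * π v < 2 * π u + n) (hu : G.dist x u = r) (hv : G.dist x v = r)
    (hwu : π w = π u) (hw : r < G.dist x w) (hwv : π w' = π v) (hw' : r < G.dist x w')
    (hout : ∀ w, r < G.dist x w → π w = π u ∨ π w = π v) :
    Separable G x r ∨ AlmostSeparable G x r := by
  subst hx
  have hn := C.two_le
  have hbn := C.gate_lt v
  have hu₁ := hu
  have hv₁ := hv
  have ca := cycDist_zero_of_two_mul_le ha'.le
  have cb := cycDist_zero_of_le_two_mul hb.le
  rw [C.dist_apply hG (by omega), ca] at hu₁
  rw [C.dist_apply hG (by omega), cb] at hv₁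
  obtain ⟨u', h₁, h₂⟩ := C.exists_dist_eq hG (w := w) (s := r + 1)
    (by rw [hwu, ca]; omega) (by omega)
  obtain ⟨v', h₃, h₄⟩ := C.exists_dist_eq hG (w := w') (s := r + 1)
    (by rw [hwv, cb]; omega) (by omega)
  rw [hwu] at h₁
  rw [hwv] at h₃
  have hu₂ := h₂
  have hv₂ := h₄
  rw [C.dist_apply hG (by omega), h₁, ca] at hu₂
  rw [C.dist_apply hG (by omega), h₃, cb] at hv₂
  have H : ∀ x' r', (∀ p ∈ ({u, u', v, v'} : Finset V),
      p ∈ gball G (φ 0) r ↔ p ∈ gball G x' r') → gball G x' r' = gball G (φ 0) r ∨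
        (2 * π x' + n = 2 * π u + 2 * π v ∧
          gball G x' r' = gball G (φ (π x')) (r + π x' - 2 * π u)) := by
    intro x' r' h
    simp only [Finset.mem_insert, Finset.mem_singleton, forall_eq_or_imp, forall_eq,
      mem_gball] at h
    have e₂ := C.dist_cases hG x' u'
    have e₄ := C.dist_cases hG x' v'
    rw [h₁, show G.dist (φ (π u)) u' = G.dist (φ (π u)) u + 1 by omega] at e₂
    rw [h₃, show G.dist (φ (π v)) v' = G.dist (φ (π v)) v + 1 by omega] at e₄
    rcases opposite_center_position ha ha' hb hab hbn (C.gate_lt x') hu₁ (by omega) (h.1.1 hu.le)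
      (by omega) (h.2.2.1.1 hv.le) (by omega) (C.dist_cases hG x' u) e₂ (C.dist_cases hG x' v)
      e₄ with ⟨h₅, h₆⟩ | ⟨h₅, h₆⟩
    · left
      rw [h₆, ← h₅]
      refine C.gball_eq_of_gate hG fun w hw => ?_
      by_contra! h
      rw [h₅] at h
      rcases hout w h with h | h <;> omega
    · refine Or.inr ⟨h₅, ?_⟩
      rw [← C.gball_eq_of_gate hG]
      · congr 1
        omega
      · intro w hw
        have h₇ : G.dist (φ 0) w ≤ r := by
          by_contra! h
          rcases hout w h with h | h <;> omega
        have := C.dist_gate_add_le hG (a := π u) (by omega) (by omega) h₇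
        rw [hw] at this
        omega
  have hS : ∃ p ∈ ({u, u', v, v'} : Finset V), p ∉ gball G (φ 0) r :=
    ⟨u', by simp, by rw [mem_gball]; omega⟩
  by_cases hm : ∃ m, 2 * m + n = 2 * π u + 2 * π v ∧
      gball G (φ m) (r + m - 2 * π u) ≠ gball G (φ 0) r
  · right
    obtain ⟨m, hm₁, hm₂⟩ := hm
    refine ⟨φ m, r + m - 2 * π u, ⟨E, n, φ, π, m, π u, π v, C.opposed_of_opposite hG ha' hb hab hu
      hv h₂ h₄ h₁ h₃ hout hm₁
      (by omega) hm₂⟩, _, Finset.card_le_four, hS, ?_⟩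
    intro x' r' h
    rcases H x' r' h with h | ⟨h₅, h₆⟩
    · exact Or.inl h
    · rw [show π x' = m by omega] at h₆
      exact Or.inr h₆
  · left
    push Not at hm
    refine ⟨_, Finset.card_le_four, hS, fun x' r' _ h => ?_⟩
    rcases H x' r' h with h | ⟨h₅, h₆⟩
    · exact h
    · rw [h₆, hm _ h₅]

end GatedCycle

namespace GatedCycle

variable {E : Set (Sym2 V)} {n : ℕ} {φ : ℕ → V} {π : V → ℕ} [DecidableEq V]

theorem separable_of_one_side (C : GatedCycle G E n φ π) (hG : G.Connected) {r : ℕ} {x : V}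
    (hmin : ∀ x' r', gball G x' r' = gball G x r → r ≤ r') (hx : φ 0 = x)
    (hne : ∃ w, r < G.dist x w) (hr : 0 < r) (hu : ∃ u, G.dist x u = r)
    (h₀ : ∀ w, π w = 0 ∨ n < 2 * π w → G.dist x w ≠ r) : Separable G x r := by
  subst hx
  have hn := C.two_le
  have h₁ : ∀ w, π w = 0 ∨ n < 2 * π w → G.dist (φ 0) w < r := by
    intro w hw
    by_contra! h
    have hwn := C.gate_lt w
    by_cases hwr : cycDist n 0 (π w) ≤ r
    · obtain ⟨w', h₂, h₃⟩ := C.exists_dist_eq hG hwr h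
      exact h₀ w' (by omega) h₃
    · have hw' : n < 2 * π w := hw.resolve_left fun h => hwr (by simp [h, cycDist])
      have h₂ : cycDist n 0 (π w) = n - π w := cycDist_zero_of_le_two_mul hw'.le
      refine h₀ (φ (n - r)) ?_ ?_
      · rw [C.gate_apply (by omega)]
        omega
      · rw [C.dist_apply hG (by omega), C.gate_apply (by omega), SimpleGraph.dist_self,
          cycDist_zero_of_le_two_mul (by omega)]
        omega
  classical
  have hex : ∃ a, ∃ u, π u = a ∧ G.dist (φ 0) u = r := by
    obtain ⟨u, hu⟩ := hu
    exact ⟨_, u, rfl, hu⟩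
  obtain ⟨u, ha, hu⟩ := Nat.find_spec hex
  have hamin : ∀ w, G.dist (φ 0) w = r → π u ≤ π w := fun w hw => by
    rw [ha]
    exact Nat.find_min' hex ⟨w, rfl, hw⟩
  clear ha
  have hu₀ : 0 < π u ∧ 2 * π u ≤ n := by
    have := h₁ u
    omega
  have har : π u ≤ r := by
    rw [C.dist_apply hG (by omega), cycDist_zero_of_two_mul_le hu₀.2] at hu
    omega
  obtain ⟨v, hv₁, hv₂, hv₃⟩ : ∃ v, G.dist (φ 0) v ≤ r ∧ r ≤ G.dist (φ 0) v + 1 ∧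
      (π v = 0 ∨ n + r < 2 * π v + G.dist (φ 0) v) := by
    have hadj := SimpleGraph.dist_eq_one_iff_adj.2 (C.adj 0 (by omega))
    have hsub : gball G (φ 1) (r - 1) ⊆ gball G (φ 0) r := by
      intro y hy
      have := hG.dist_triangle (u := φ 0) (v := φ 1) (w := y)
      rw [mem_gball] at hy ⊢
      simp only [zero_add] at hadj
      omega
    have hnsub : ¬ gball G (φ 0) r ⊆ gball G (φ 1) (r - 1) := fun h => by
      have := hmin _ _ (hsub.antisymm h)
      omega
    obtain ⟨v, h₂, h₃⟩ := Set.not_subset.1 hnsub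
    rw [mem_gball] at h₂ h₃
    have h₄ := h₁ v
    have hvn := C.gate_lt v
    refine ⟨v, h₂, ?_⟩
    rw [C.dist_apply hG (by omega)] at h₂ h₃ h₄ ⊢
    by_cases hv : π v = 0
    · rw [hv] at h₂ h₃ h₄ ⊢
      have c₀ : cycDist n 0 0 = 0 := by simp [cycDist]
      have c₁ : cycDist n 1 0 = 1 := by unfold cycDist; omega
      omega
    by_cases hv' : n < 2 * π v
    · have c₀ : cycDist n 0 (π v) = n - π v := cycDist_zero_of_le_two_mul hv'.le
      have c₁ : cycDist n 1 (π v) ≤ n - π v + 1 ∧ cycDist n 1 (π v) ≤ π v - 1 := by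
        unfold cycDist; omega
      omega
    · have c₀ : cycDist n 0 (π v) = π v := cycDist_zero_of_two_mul_le (by omega)
      have c₁ : cycDist n 1 (π v) = π v - 1 := by unfold cycDist; omega
      omega
  have hout : ∀ w, r < G.dist (φ 0) w → π u ≤ π w ∧ 2 * π w ≤ n := by
    intro w hw
    have h₂ := h₁ w
    refine ⟨?_, by omega⟩
    by_contra! hwu
    obtain ⟨w', h₃, h₄⟩ := C.exists_dist_eq hG (w := w) (s := r)
      (by rw [cycDist_zero_of_two_mul_le (by omega)]; omega) (by omega)
    have := hamin w' h₄
    omega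
  obtain ⟨w, hw⟩ := hne
  by_cases hbeyond : ∃ w, r < G.dist (φ 0) w ∧ π u < π w
  · obtain ⟨w, hw, huw⟩ := hbeyond
    exact C.separable_of_beyond hG rfl hu₀.1 huw (hout w hw).2 hu hw hv₁ hv₂ hv₃
  · push Not at hbeyond
    have heq : ∀ w, r < G.dist (φ 0) w → π w = π u := fun w hw =>
      (hbeyond w hw).antisymm (hout w hw).1
    exact C.separable_of_forall hG hmin rfl hu₀.1 hu₀.2 hu (heq w hw) hw hv₁ hv₂ hv₃
      fun w hw => Or.inl (heq w hw)

theorem separable_or_of_two_sides (C : GatedCycle G E n φ π) (hG : G.Connected) {r : ℕ} {x : V}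
    (hmin : ∀ x' r', gball G x' r' = gball G x r → r ≤ r') (hx : φ 0 = x)
    (hne : ∃ w, r < G.dist x w) (h₀ : ∀ w, π w = 0 → G.dist x w ≠ r)
    (hu : ∃ u, 0 < π u ∧ 2 * π u < n ∧ G.dist x u = r)
    (hv : ∃ v, n < 2 * π v ∧ G.dist x v = r) :
    Separable G x r ∨ AlmostSeparable G x r := by
  have C' := C.reflect
  have hn := C.two_le
  have hx' : φ (n - 0) = x := by rw [Nat.sub_zero, C.closed, hx]
  classical
  obtain ⟨u, hu₁, hu₂, hu, humin⟩ : ∃ u, 0 < π u ∧ 2 * π u < n ∧ G.dist x u = r ∧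
      ∀ w, 0 < π w → 2 * π w < n → G.dist x w = r → π u ≤ π w := by
    have hex : ∃ a, ∃ u, π u = a ∧ 0 < π u ∧ 2 * π u < n ∧ G.dist x u = r := by
      obtain ⟨u, hu⟩ := hu
      exact ⟨_, u, rfl, hu⟩
    obtain ⟨u, ha, h₁, h₂, h₃⟩ := Nat.find_spec hex
    refine ⟨u, h₁, h₂, h₃, fun w h₄ h₅ h₆ => ?_⟩
    rw [ha]
    exact Nat.find_min' hex ⟨w, rfl, h₄, h₅, h₆⟩
  obtain ⟨v, hv₁, hv, hvmin⟩ : ∃ v, n < 2 * π v ∧ G.dist x v = r ∧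
      ∀ w, n < 2 * π w → G.dist x w = r → π w ≤ π v := by
    have hex : ∃ b, ∃ v, n - π v = b ∧ n < 2 * π v ∧ G.dist x v = r := by
      obtain ⟨v, hv⟩ := hv
      exact ⟨_, v, rfl, hv⟩
    obtain ⟨v, hb, h₁, h₂⟩ := Nat.find_spec hex
    refine ⟨v, h₁, h₂, fun w h₃ h₄ => ?_⟩
    have := Nat.find_min' hex ⟨w, rfl, h₃, h₄⟩
    have := C.gate_lt w
    omega
  have hvn := C.gate_lt v
  have hout : ∀ w, r < G.dist x w → π u ≤ π w ∧ π w ≤ π v := by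
    intro w hw
    have hwn := C.gate_lt w
    have key : cycDist n 0 (π w) ≤ r → ∃ w', π w' = π w ∧ G.dist x w' = r := fun h => by
      subst hx
      exact C.exists_dist_eq hG h hw.le
    have har : π u ≤ r := by
      rw [← hx, C.dist_apply hG (by omega), cycDist_zero_of_two_mul_le hu₂.le] at hu
      omega
    have hbr : n - π v ≤ r := by
      rw [← hx, C.dist_apply hG (by omega), cycDist_zero_of_le_two_mul hv₁.le] at hv
      omega
    constructor
    · by_contra! h
      rw [cycDist_zero_of_two_mul_le (by omega)] at key
      obtain ⟨w', h₁, h₂⟩ := key (by omega)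
      rcases Nat.eq_zero_or_pos (π w) with h₃ | h₃
      · exact h₀ w' (by omega) h₂
      · have := humin w' (by omega) (by omega) h₂
        omega
    · by_contra! h
      rw [cycDist_zero_of_le_two_mul (by omega)] at key
      obtain ⟨w', h₁, h₂⟩ := key (by omega)
      have := hvmin w' (by omega) h₂
      omega
  have πu' : (if π u = 0 then 0 else n - π u) = n - π u := if_neg (by omega)
  have πv' : (if π v = 0 then 0 else n - π v) = n - π v := if_neg (by omega)
  by_cases h₁ : ∃ w, r < G.dist x w ∧ π u < π w ∧ 2 * π w ≤ n
  · obtain ⟨w, h₁, h₂, h₃⟩ := h₁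
    exact Or.inl (C.separable_of_beyond hG hx hu₁ h₂ h₃ hu h₁ hv.le (by omega)
      (Or.inr (by omega)))
  by_cases h₂ : ∃ w, r < G.dist x w ∧ π w < π v ∧ n < 2 * π w
  · obtain ⟨w, h₁, h₂, h₃⟩ := h₂
    have πw' : (if π w = 0 then 0 else n - π w) = n - π w := if_neg (by omega)
    refine Or.inl (C'.separable_of_beyond hG hx' (u := v) (v := u) (w := w) ?_ ?_ ?_ hv h₁ hu.le
      (by omega) (Or.inr ?_)) <;> simp only [πu', πv', πw'] <;> omega
  push Not at h₁ h₂
  have hout' : ∀ w, r < G.dist x w → π w = π u ∨ π w = π v := by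
    intro w hw
    have := h₁ w hw
    have := h₂ w hw
    have := hout w hw
    omega
  by_cases h₃ : ∃ w, r < G.dist x w ∧ π w = π u
  · obtain ⟨w, hw, hwu⟩ := h₃
    by_cases hab : 2 * π u + n ≤ 2 * π v ∨ ∀ w, r < G.dist x w → π w = π u
    · refine Or.inl (C.separable_of_forall hG hmin hx hu₁ hu₂.le hu hwu hw hv.le (by omega)
        (Or.inr (by omega)) fun w hw => ?_)
      rcases hab with hab | hab
      · have := hout' w hw
        omega
      · exact Or.inl (hab w hw)
    · push Not at hab
      obtain ⟨hab, w', hw', hwu'⟩ := hab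
      exact C.separable_or_of_opposite hG hmin hx hu₁ hu₂ hv₁ hab hu hv hwu hw
        ((hout' w' hw').resolve_left hwu') hw' hout'
  · push Not at h₃
    have hv' : ∀ w, r < G.dist x w → π w = π v := fun w hw =>
      (hout' w hw).resolve_left (h₃ w hw)
    obtain ⟨w, hw⟩ := hne
    refine Or.inl (C'.separable_of_forall hG hmin hx' (u := v) (v := u) (w := w) ?_ ?_ hv ?_ hw
      hu.le (by omega) (Or.inr ?_) fun w hw => Or.inl ?_)
    · simp only [πv']; omega
    · simp only [πv']; omega
    · simp only [hv' w hw]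
    · simp only [πu']; omega
    · simp only [hv' w hw]

theorem separable_or (C : GatedCycle G E n φ π) (hG : G.Connected) {r : ℕ} {x u : V}
    (hmin : ∀ x' r', gball G x' r' = gball G x r → r ≤ r') (hx : φ 0 = x)
    (hne : ∃ w, r < G.dist x w) (hr : 0 < r) (hu₀ : π u ≠ 0) (hu : G.dist x u = r) :
    Separable G x r ∨ AlmostSeparable G x r := by
  have hn := C.two_le
  by_cases h₀ : ∃ v, π v = 0 ∧ G.dist x v = r
  · left
    obtain ⟨v, hv₀, hv⟩ := h₀
    obtain ⟨w, hw⟩ := hne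
    refine ⟨{u, v, w}, Finset.card_le_three.trans (by omega), ⟨w, by simp, ?_⟩, ?_⟩
    · rw [mem_gball]; omega
    intro x' r' hr' h
    simp only [Finset.mem_insert, Finset.mem_singleton, forall_eq_or_imp, forall_eq,
      mem_gball] at h
    have hu' := h.1.1 hu.le
    have hv' := h.2.1.1 hv.le
    subst hx
    have hun := C.gate_lt u
    have hxn := C.gate_lt x'
    have e₁ := C.dist_cases hG x' u
    have e₂ := C.dist_cases hG x' v
    rw [C.dist_apply hG (by omega)] at hu hv
    rw [hv₀] at e₂ hv
    have c₀ : cycDist n 0 0 = 0 := by simp [cycDist]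
    have key : π x' = 0 ∧ G.dist (φ (π x')) x' = 0 ∧ r' = r := by
      by_cases hx : π x' = 0
      · have : 0 < cycDist n 0 (π u) := by unfold cycDist; omega
        rw [hx] at e₁ e₂
        rw [hx]
        omega
      · have : 0 < cycDist n (π x') 0 := by unfold cycDist; omega
        omega
    obtain ⟨h₁, h₂, rfl⟩ := key
    rw [hG.dist_eq_zero_iff, h₁] at h₂
    rw [h₂]
  push Not at h₀
  by_cases hN : ∃ v, n < 2 * π v ∧ G.dist x v = r
  · by_cases hP : ∃ u, 0 < π u ∧ 2 * π u < n ∧ G.dist x u = r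
    · exact C.separable_or_of_two_sides hG hmin hx hne h₀ hP hN
    · push Not at hP
      refine Or.inl (C.reflect.separable_of_one_side hG hmin
        (by rw [Nat.sub_zero, C.closed, hx]) hne hr ⟨u, hu⟩ ?_)
      intro w hw
      have hwn := C.gate_lt w
      split_ifs at hw with h
      · exact h₀ w h
      · exact hP w (by omega) (by omega)
  · push Not at hN
    refine Or.inl (C.separable_of_one_side hG hmin hx hne hr ⟨u, hu⟩ ?_)
    rintro w (h | h)
    · exact h₀ w h
    · exact hN w h

end GatedCycle

theorem separable_or_almostSeparable [DecidableEq V] (hG : IsCactus G) {r : ℕ} {x : V}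
    (hmin : ∀ x' r', gball G x' r' = gball G x r → r ≤ r') (hne : gball G x r ≠ Set.univ) :
    Separable G x r ∨ AlmostSeparable G x r := by
  obtain ⟨w, hw⟩ := (Set.ne_univ_iff_exists_notMem _).1 hne
  rw [mem_gball, not_le] at hw
  rcases Nat.eq_zero_or_pos r with rfl | hr
  · left
    refine ⟨{x, w}, Finset.card_le_two.trans (by omega), ⟨w, by simp, ?_⟩, ?_⟩
    · rw [mem_gball]; omega
    intro x' r' hr' h
    simp only [Finset.mem_insert, Finset.mem_singleton, forall_eq_or_imp, forall_eq,
      mem_gball, SimpleGraph.dist_self] at h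
    have := h.1.1 le_rfl
    obtain rfl : r' = 0 := by omega
    rw [(hG.1.dist_eq_zero_iff).1 (Nat.le_zero.1 this)]
  obtain ⟨u, hu⟩ : ∃ u, G.dist x u = r := by
    by_contra! h
    have := hmin x (r - 1) (by
      ext y
      have := h y
      rw [mem_gball, mem_gball]
      omega)
    omega
  have hux : u ≠ x := by
    rintro rfl
    rw [SimpleGraph.dist_self] at hu
    omega
  obtain ⟨E, n, φ, π, C, hx, hu₀⟩ := exists_gate_of_ne hG hux
  exact C.separable_or hG.1 hmin hx ⟨w, hw⟩ hr hu₀ hu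
theorem cycDist_triangle {n i j k : ℕ} (hi : i < n) (hj : j < n) (hk : k < n) :
    cycDist n i k ≤ cycDist n i j + cycDist n j k := by
  have s₁ := cycDist_spec hi hj
  have s₂ := cycDist_spec hj hk
  have s₃ : cycDist n i k ≤ max i k - min i k ∧ cycDist n i k ≤ n - (max i k - min i k) := by
    unfold cycDist; omega
  generalize cycDist n i k = z at *
  generalize cycDist n i j = x at *
  generalize cycDist n j k = y at *
  rcases s₁ with s₁ | s₁ | s₁ | s₁ <;> rcases s₂ with s₂ | s₂ | s₂ | s₂ <;> omega

theorem cycDist_between {n m a b : ℕ} (hm : m < n) (ha : a < n) (hb : b < n)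
    (h : cycDist n a m + cycDist n m b = cycDist n a b) (h' : 2 * cycDist n a b < n) :
    ((m = a + cycDist n a m ∨ m + n = a + cycDist n a m) ∧
      (b = a + cycDist n a b ∨ b + n = a + cycDist n a b)) ∨
    ((a = m + cycDist n a m ∨ a + n = m + cycDist n a m) ∧
      (a = b + cycDist n a b ∨ a + n = b + cycDist n a b)) := by
  have s₁ := cycDist_spec ha hm
  have s₂ := cycDist_spec hm hb
  have s₃ := cycDist_spec ha hb
  generalize cycDist n a b = z at *
  generalize cycDist n a m = x at *
  generalize cycDist n m b = y at *
  rcases s₁ with s₁ | s₁ | s₁ | s₁ <;> rcases s₂ with s₂ | s₂ | s₂ | s₂ <;>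
    rcases s₃ with s₃ | s₃ | s₃ | s₃ <;> first | (exfalso; omega) | (left; omega) | (right; omega)

theorem eq_of_between {n i m a b k : ℕ} (hi : i < n) (hm : m < n) (ha : a < n) (hb : b < n)
    (h : cycDist n a m + cycDist n m b = cycDist n a b) (h' : 2 * cycDist n a b < n)
    (h₁ : k + cycDist n i a = cycDist n m a) (h₂ : k + cycDist n i b = cycDist n m b) :
    i = m ∧ k = 0 := by
  have h₃ := cycDist_comm n m a
  have h₄ := cycDist_comm n i a
  have h₅ := cycDist_triangle ha hi hb
  have h₆ := cycDist_between hm ha hb h h'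
  have h₇ := cycDist_between hi ha hb (by omega) h'
  refine ⟨?_, by omega⟩
  have h₈ : cycDist n a i = cycDist n a m := by omega
  have h₉ : cycDist n a m ≤ cycDist n a b := by omega
  rw [h₈] at h₇
  clear h₁ h₂ h₃ h₄ h₅ h h₈
  generalize cycDist n a b = z at *
  generalize cycDist n a m = x at *
  omega

theorem cycDist_lt_add {n c m b w y : ℕ} (hc : c < n) (hb : b < n) (hw : 0 < w)
    (hy : 0 < y) (h : ((c = m + w ∨ c + n = m + w) ∧ (b = m + y ∨ b + n = m + y)) ∨
      ((m = c + w ∨ m + n = c + w) ∧ (m = b + y ∨ m + n = b + y))) :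
    cycDist n c b < w + y := by
  have e : cycDist n c b ≤ max c b - min c b ∧ cycDist n c b ≤ n - (max c b - min c b) := by
    unfold cycDist; omega
  omega

theorem cycDist_lt_of_between {n c m a b : ℕ} (hc : c < n) (hm : m < n) (ha : a < n) (hb : b < n)
    (hcm : c ≠ m) (ham : a ≠ m) (hbm : b ≠ m)
    (h : cycDist n a m + cycDist n m b = cycDist n a b) (h' : 2 * cycDist n a b < n) :
    cycDist n c a < cycDist n c m + cycDist n m a ∨
      cycDist n c b < cycDist n c m + cycDist n m b := by
  have h₃ := cycDist_comm n m a
  have h₆ := cycDist_between hm ha hb h h'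
  have p₁ : 0 < cycDist n m a := by unfold cycDist; omega
  have p₂ : 0 < cycDist n m b := by unfold cycDist; omega
  have p₃ : 0 < cycDist n c m := by unfold cycDist; omega
  have s₆ : (c = m + cycDist n c m ∨ c + n = m + cycDist n c m) ∨
      (m = c + cycDist n c m ∨ m + n = c + cycDist n c m) := by
    unfold cycDist; omega
  have q : ((m = a + cycDist n m a ∨ m + n = a + cycDist n m a) ∧
      (b = m + cycDist n m b ∨ b + n = m + cycDist n m b)) ∨
    ((a = m + cycDist n m a ∨ a + n = m + cycDist n m a) ∧
      (m = b + cycDist n m b ∨ m + n = b + cycDist n m b)) := by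
    clear s₆
    generalize cycDist n a b = z at *
    generalize cycDist n a m = x at *
    generalize cycDist n m b = y at *
    subst h₃
    rcases h₆ with ⟨h₁ | h₁, h₂ | h₂⟩ | ⟨h₁ | h₁, h₂ | h₂⟩ <;> omega
  rcases q with ⟨q₁, q₂⟩ | ⟨q₁, q₂⟩ <;> rcases s₆ with s₆ | s₆
  · exact .inr (cycDist_lt_add hc hb p₃ p₂ (.inl ⟨s₆, q₂⟩))
  · exact .inl (cycDist_lt_add hc ha p₃ p₁ (.inr ⟨s₆, q₁⟩))
  · exact .inl (cycDist_lt_add hc ha p₃ p₁ (.inl ⟨s₆, q₁⟩))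
  · exact .inr (cycDist_lt_add hc hb p₃ p₂ (.inr ⟨s₆, q₂⟩))

namespace Opposed

variable {B B' : Set V} {z : V} {q : ℕ} {E : Set (Sym2 V)} {n : ℕ} {φ : ℕ → V} {π : V → ℕ}
  {m a b : ℕ}

theorem center_unique (O : Opposed G B z q E n φ π m a b) (hG : G.Connected) {u v x' : V} {r' : ℕ}
    (hu : π u = a) (hv : π v = b) (hzu : G.dist z u = q) (hzv : G.dist z v = q) (hr' : r' ≤ q)
    (hxu : G.dist x' u ≤ r') (hxv : G.dist x' v ≤ r') : x' = z ∧ r' = q := by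
  have C := O.gated
  have ham : 0 < cycDist n a m := by
    have := O.lt_a; have := O.lt_m; have := O.ne_a
    unfold cycDist; omega
  have hmb : 0 < cycDist n m b := by
    have := O.lt_b; have := O.lt_m; have := O.ne_b
    unfold cycDist; omega
  have hbt := O.between
  have hab : a ≠ b := by
    rintro rfl
    have : cycDist n a a = 0 := by unfold cycDist; omega
    omega
  have hma := cycDist_comm n m a
  have huv := C.dist_eq hG (u := u) (v := v) (by rwa [hu, hv])
  have htri := hG.dist_triangle (u := u) (v := x') (w := v)
  rw [SimpleGraph.dist_comm (u := u) (v := x')] at htri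
  rw [← O.apply_m, C.dist_apply hG O.lt_m] at hzu hzv
  have cu := C.dist_cases hG x' u
  have cv := C.dist_cases hG x' v
  rw [hu] at huv hzu cu
  rw [hv] at huv hzv cv
  have hra : π x' ≠ a := by
    intro h
    rw [h] at cv
    rcases cv with ⟨-, cv⟩ | ⟨cv, -⟩
    · omega
    · exact hab cv
  have hrb : π x' ≠ b := by
    intro h
    rw [h, cycDist_comm] at cu
    rcases cu with ⟨-, cu⟩ | ⟨cu, -⟩
    · omega
    · exact hab cu.symm
  obtain ⟨h₁, h₂⟩ := eq_of_between (k := G.dist (φ (π x')) x') (C.gate_lt x') O.lt_m O.lt_a O.lt_b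
    hbt O.short (by omega) (by omega)
  rw [h₁, O.apply_m, hG.dist_eq_zero_iff] at h₂
  exact ⟨h₂.symm, by omega⟩

/-- A vertex outside of the ball around `z` sees one of the two opposite branches, along which a
path through `z` is not geodesic. -/
theorem exists_short (O : Opposed G B z q E n φ π m a b) (hG : G.Connected) {w : V}
    (hm : π w ≠ m) (ha : π w ≠ a) (hb : π w ≠ b) :
    ∃ w', π w' ≠ m ∧ π w' ≠ π w ∧ G.dist z w' = q + 1 ∧
      G.dist w w' < G.dist z w + G.dist z w' := by
  have C := O.gated
  obtain ⟨u, hu, hzu⟩ := O.exists_a'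
  obtain ⟨v, hv, hzv⟩ := O.exists_b'
  have key : ∀ w', π w' ≠ π w → cycDist n (π w) (π w') < cycDist n (π w) m + cycDist n m (π w') →
      G.dist w w' < G.dist z w + G.dist z w' := by
    intro w' h₁ h₂
    have h₃ := C.dist_eq hG h₁.symm
    have h₄ := cycDist_comm n (π w) m
    rw [← O.apply_m, C.dist_apply hG O.lt_m, C.dist_apply hG O.lt_m]
    omega
  rcases cycDist_lt_of_between (C.gate_lt w) O.lt_m O.lt_a O.lt_b hm O.ne_a O.ne_b O.between
    O.short with h | h
  · refine ⟨u, hu ▸ O.ne_a, hu ▸ ha.symm, hzu, key u (hu ▸ ha.symm) (hu ▸ h)⟩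
  · refine ⟨v, hv ▸ O.ne_b, hv ▸ hb.symm, hzv, key v (hv ▸ hb.symm) (hv ▸ h)⟩

theorem mem_or_mem [DecidableEq V] (hG : IsCactus G) {E' : Set (Sym2 V)} {n' : ℕ} {φ' : ℕ → V}
    {π' : V → ℕ} {m' a' b' : ℕ} (O : Opposed G B z q E n φ π m a b)
    (O' : Opposed G B' z q E' n' φ' π' m' a' b') {w w' : V} (hm : π w ≠ m) (hw : q < G.dist z w)
    (hww' : π w' ≠ π w) (h : G.dist w w' < G.dist z w + G.dist z w') : w ∈ B' ∨ w' ∈ B' := by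
  by_contra! hB
  have C := O'.gated
  rcases O.gated.gate_eq_or hG C O.lt_m O'.lt_m (O.apply_m.trans O'.apply_m.symm) with h₁ | h₁
  · have h₂ : π' w ≠ π' w' := fun h₃ ↦ hww' ((h₁ _ _).2 h₃).symm
    have h₃ := C.dist_eq hG.1 h₂
    have h₄ := O'.between
    have h₅ := cycDist_comm n' a' m'
    have h₆ := cycDist_comm n' m' b'
    have h₇ := cycDist_comm n' a' b'
    rw [← O'.apply_m, C.dist_apply hG.1 O'.lt_m, C.dist_apply hG.1 O'.lt_m] at h
    rcases O'.gate_of_notMem w hB.1 with h₈ | h₈ <;>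
      rcases O'.gate_of_notMem w' hB.2 with h₉ | h₉ <;> rw [h₈, h₉] at h₂ h₃ <;> rw [h₈, h₉] at h
    · exact h₂ rfl
    · omega
    · omega
    · exact h₂ rfl
  · exact absurd (O'.dist_le_of_gate w (h₁ w hm)) (by omega)

end Opposed

namespace Partner

variable {B B' : Set V} {z z' : V} {q q' : ℕ}

theorem gball_ne_univ (h : Partner G B z q) : gball G z q ≠ Set.univ := by
  obtain ⟨E, n, φ, π, m, a, b, O⟩ := h
  obtain ⟨w, hw, -⟩ := O.exists_far
  intro h
  have : w ∈ gball G z q := h ▸ Set.mem_univ w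
  exact absurd this (by rw [mem_gball]; omega)

theorem center_unique (hG : G.Connected) (h : Partner G B z q) (h' : Partner G B' z' q')
    (e : gball G z q = gball G z' q') : z' = z ∧ q' = q := by
  wlog hq : q' ≤ q generalizing B B' z z' q q'
  · obtain ⟨h₁, h₂⟩ := this h' h e.symm (by omega)
    exact ⟨h₁.symm, h₂.symm⟩
  obtain ⟨E, n, φ, π, m, a, b, O⟩ := h
  obtain ⟨u, hu, hzu⟩ := O.exists_a
  obtain ⟨v, hv, hzv⟩ := O.exists_b
  refine O.center_unique hG hu hv hzu hzv hq ?_ ?_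
  · rw [← mem_gball, ← e]; exact hzu.le
  · rw [← mem_gball, ← e]; exact hzv.le

theorem exists_finset [DecidableEq V] (hG : IsCactus G) (h : Partner G B z q) :
    ∃ S : Finset V, S.card ≤ 4 ∧ (∃ p ∈ S, p ∉ gball G z q) ∧
      (∀ x' r', r' ≤ q → (∀ p ∈ S, p ∈ gball G z q ↔ p ∈ gball G x' r') →
        gball G x' r' = gball G z q) ∧
      ∀ B', Partner G B' z q → ∃ p ∈ S, p ∈ B' ∧ p ∉ gball G z q := by
  obtain ⟨E, n, φ, π, m, a, b, O⟩ := h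
  obtain ⟨u, hu, hzu⟩ := O.exists_a
  obtain ⟨v, hv, hzv⟩ := O.exists_b
  obtain ⟨w, hw, hwa, hwb⟩ := O.exists_far
  have hwm : π w ≠ m := fun h ↦ by
    have := O.dist_le_of_gate w h
    omega
  obtain ⟨w', hwm', hww', hw', hlt⟩ := O.exists_short hG.1 hwm hwa hwb
  have nw : w ∉ gball G z q := by rw [mem_gball]; omega
  have nw' : w' ∉ gball G z q := by rw [mem_gball]; omega
  refine ⟨{u, v, w, w'}, Finset.card_le_four, ⟨w, by simp, nw⟩, ?_, ?_⟩
  · intro x' r' hr' hS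
    obtain ⟨rfl, rfl⟩ := O.center_unique hG.1 hu hv hzu hzv hr'
      ((hS u (by simp)).1 hzu.le) ((hS v (by simp)).1 hzv.le)
    rfl
  · rintro B' ⟨E', n', φ', π', m', a', b', O'⟩
    rcases O.mem_or_mem hG O' hwm hw hww' hlt with h | h
    · exact ⟨w, by simp, h, nw⟩
    · exact ⟨w', by simp, h, nw'⟩

end Partner

/-- The least radius of the ball `B`. -/
noncomputable def minRadius (G : SimpleGraph V) (B : Set V) : ℕ :=
  sInf {r | ∃ x, B = gball G x r}

theorem minRadius_le {x : V} {r : ℕ} : minRadius G (gball G x r) ≤ r :=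
  Nat.sInf_le ⟨x, rfl⟩

theorem exists_eq_gball_minRadius {B : Set V} (hB : B ∈ gballs G) :
    ∃ x, B = gball G x (minRadius G B) := by
  obtain ⟨x, r, h⟩ := hB
  exact Nat.sInf_mem (s := {r | ∃ x, B = gball G x r}) ⟨r, x, h⟩

/-- The finset `S` distinguishes the ball `B` from sufficiently many other balls. -/
structure Teaches (G : SimpleGraph V) (B : Set V) (S : Finset V) : Prop where
  exists_notMem : ∃ p ∈ S, p ∉ B
  eq_or : ∀ B' ∈ gballs G, minRadius G B' ≤ minRadius G B → (∀ p ∈ S, p ∈ B ↔ p ∈ B') →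
    B' = B ∨ ∃ z q, Partner G B z q ∧ B' = gball G z q
  exists_mem : ∀ B' z q, Partner G B' z q → B = gball G z q → ∃ p ∈ S, p ∈ B' ∧ p ∉ B

theorem exists_teaches [DecidableEq V] (hG : IsCactus G) {B : Set V} (hB : B ∈ gballs G)
    (hne : B ≠ Set.univ) : ∃ S : Finset V, S.card ≤ 4 ∧ Teaches G B S := by
  by_cases hP : ∃ B' z q, Partner G B' z q ∧ B = gball G z q
  · obtain ⟨B', z, q, hP, rfl⟩ := hP
    obtain ⟨S, h₁, h₂, h₃, h₄⟩ := hP.exists_finset hG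
    refine ⟨S, h₁, h₂, ?_, ?_⟩
    · intro B'' hB'' hle hS
      obtain ⟨x', hx'⟩ := exists_eq_gball_minRadius hB''
      rw [hx'] at hS ⊢
      exact .inl (h₃ _ _ (hle.trans minRadius_le) hS)
    · intro B'' z' q' hP' e
      obtain ⟨rfl, rfl⟩ := hP.center_unique hG.1 hP' e
      exact h₄ _ hP'
  · obtain ⟨x, hx⟩ := exists_eq_gball_minRadius hB
    have hmin : ∀ x' r', gball G x' r' = gball G x (minRadius G B) → minRadius G B ≤ r' := by
      intro x' r' h
      rw [hx, ← h]
      exact minRadius_le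
    have hvac : ∀ B' z q, Partner G B' z q → B = gball G z q → False :=
      fun B' z q h e ↦ hP ⟨B', z, q, h, e⟩
    rcases separable_or_almostSeparable hG hmin (hx ▸ hne) with h | h
    · obtain ⟨S, h₁, h₂, h₃⟩ := h
      rw [← hx] at h₂ h₃
      refine ⟨S, h₁, h₂, ?_, fun B' z q h e ↦ (hvac B' z q h e).elim⟩
      intro B' hB' hle hS
      obtain ⟨x', hx'⟩ := exists_eq_gball_minRadius hB'
      rw [hx'] at hS ⊢
      exact .inl (h₃ _ _ hle hS)
    · obtain ⟨z, q, h₀, S, h₁, h₂, h₃⟩ := h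
      rw [← hx] at h₀ h₂ h₃
      refine ⟨S, h₁, h₂, ?_, fun B' z q h e ↦ (hvac B' z q h e).elim⟩
      rintro B' ⟨x', r', rfl⟩ - hS
      exact (h₃ x' r' hS).imp_right fun h ↦ ⟨z, q, h₀, h⟩

theorem eq_of_teaches {T : Set V → Finset V}
    (hT : ∀ B ∈ gballs G, B ≠ Set.univ → Teaches G B (T B)) {B B' : Set V} (hB : B ∈ gballs G)
    (hB' : B' ∈ gballs G) (h : ∀ p ∈ T B, p ∈ B ↔ p ∈ B') (h' : ∀ p ∈ T B', p ∈ B ↔ p ∈ B') :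
    B = B' := by
  wlog hle : minRadius G B' ≤ minRadius G B generalizing B B'
  · exact (this hB' hB (fun p hp ↦ (h' p hp).symm) (fun p hp ↦ (h p hp).symm) (by omega)).symm
  by_cases hU : B = Set.univ
  · by_contra hne
    obtain ⟨p, hp, hp'⟩ := (hT B' hB' fun e ↦ hne (hU.trans e.symm)).exists_notMem
    exact hp' ((h' p hp).1 (hU ▸ Set.mem_univ p))
  · rcases (hT B hB hU).eq_or B' hB' hle h with e | ⟨z, q, hP, e⟩
    · exact e.symm
    · obtain ⟨p, hp, h₁, h₂⟩ := (hT B' hB' (e ▸ hP.gball_ne_univ)).exists_mem B z q hP e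
      exact absurd ((h' p hp).1 h₁) h₂

end Cactus

/-- For every finite tree of cycles `K`, the family `B(K)` of balls of `K` admits a
non-clashing teaching map of size at most `4`, i.e. `NCTD(B(K)) ≤ 4`. -/
theorem stmt15 {V : Type*} [Fintype V] [DecidableEq V] (G : SimpleGraph V)
    (hG : IsCactus G) :
    ∃ Tp Tn : Set V → Finset V,
      IsNCTM (gballs G) Tp Tn ∧ ∀ C ∈ gballs G, (Tp C ∪ Tn C).card ≤ 4 := by
  classical
  have hT : ∀ B : Set V, ∃ S : Finset V, S.card ≤ 4 ∧
      (B ∈ gballs G → B ≠ Set.univ → Cactus.Teaches G B S) := by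
    intro B
    by_cases hB : B ∈ gballs G ∧ B ≠ Set.univ
    · obtain ⟨S, h₁, h₂⟩ := Cactus.exists_teaches hG hB.1 hB.2
      exact ⟨S, h₁, fun _ _ ↦ h₂⟩
    · exact ⟨∅, by simp, fun h₁ h₂ ↦ (hB ⟨h₁, h₂⟩).elim⟩
  choose T hcard hT using hT
  have hunion : ∀ C, (T C).filter (· ∈ C) ∪ (T C).filter (· ∉ C) = T C :=
    fun C ↦ Finset.filter_union_filter_not_eq _ _
  refine ⟨fun C ↦ (T C).filter (· ∈ C), fun C ↦ (T C).filter (· ∉ C), ⟨?_, ?_, ?_⟩, ?_⟩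
  · intro C _ p hp
    exact (Finset.mem_filter.1 hp).2
  · intro C _ p hp
    exact (Finset.mem_filter.1 hp).2
  · intro C hC C' hC' hne
    simp only [hunion]
    by_contra! h
    refine hne (Cactus.eq_of_teaches hT hC hC' ?_ ?_)
    · intro p hp
      exact not_not.1 fun h' ↦ h p (Finset.mem_union_left _ hp) (xor_iff_not_iff _ _ |>.2 h')
    · intro p hp
      exact not_not.1 fun h' ↦ h p (Finset.mem_union_right _ hp) (xor_iff_not_iff _ _ |>.2 h')
  · intro C _
    simp only [hunion]
    exact hcard C
end
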